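/- Let 𝔓 = (P, A) be a polyhedral graph with face set R in which every point (vertex) has even valency. Then there is a proper 2-colouring c : R → {c_1, c_2} of the faces, i.e. no two adjacent faces receive the same colour. -/

import Mathlib

noncomputable section

/-- The 2-sphere `S²`, as the unit sphere in `ℝ³`. -/
abbrev Sph : Type := Metric.sphere (0 : EuclideanSpace ℝ (Fin 3)) 1

/-- An embedding of a simple graph in the sphere `S²`: an injective placement of the
vertices together with injective continuous arcs for the edges, so that the open arc
of an edge avoids all vertices and the arcs of two distinct edges meet only in
vertices. -/
structure SphereEmbedding {V : Type*} (G : SimpleGraph V) where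
  pos : V → Sph
  pos_inj : Function.Injective pos
  arc : ∀ ⦃u v : V⦄, G.Adj u v → Path (pos u) (pos v)
  arc_symm : ∀ ⦃u v : V⦄ (h : G.Adj u v), arc h.symm = (arc h).symm
  arc_inj : ∀ ⦃u v : V⦄ (h : G.Adj u v), Function.Injective (arc h)
  arc_avoid : ∀ ⦃u v : V⦄ (h : G.Adj u v) (w : V),
    pos w ∈ Set.range (arc h) → w = u ∨ w = v
  arc_disj : ∀ ⦃u v u' v' : V⦄ (h : G.Adj u v) (h' : G.Adj u' v'),
    s(u, v) ≠ s(u', v') →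
    Set.range (arc h) ∩ Set.range (arc h') ⊆
      ({pos u, pos v} : Set Sph) ∩ {pos u', pos v'}

namespace SphereEmbedding

variable {V : Type*} {G : SimpleGraph V} (F : SphereEmbedding G)

/-- The subset of the sphere occupied by the embedded graph. -/
def image : Set Sph :=
  Set.range F.pos ∪ ⋃ p : {p : V × V // G.Adj p.1 p.2}, Set.range (F.arc p.2)

/-- The faces of the embedding: the connected components of the complement of the
embedded graph. -/
def Faces : Set (Set Sph) :=
  {S | ∃ x : Sph, x ∉ F.image ∧ S = connectedComponentIn F.imageᶜ x}

/-- The open arc of an edge: the arc with its endpoints removed. -/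
def openArc ⦃u v : V⦄ (h : G.Adj u v) : Set Sph :=
  Set.range (F.arc h) \ ({F.pos u, F.pos v} : Set Sph)

/-- Two faces are adjacent when they share an arc: the open arc of some edge is
contained in the closure of both. -/
def FaceAdj (S T : Set Sph) : Prop :=
  ∃ (u v : V) (h : G.Adj u v), F.openArc h ⊆ closure S ∧ F.openArc h ⊆ closure T

/-- The degree of a face: the number of edges whose open arc lies on its boundary. -/
def faceDeg (S : Set Sph) : ℕ :=
  Nat.card {e : Sym2 V // ∃ (u v : V) (h : G.Adj u v),
    e = s(u, v) ∧ F.openArc h ⊆ closure S}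

end SphereEmbedding
/-- `f` has a continuous logarithm on `K`. -/
def LogOn (K : Set ℂ) (f : ℂ → ℂ) : Prop :=
  ∃ u : ℂ → ℂ, ContinuousOn u K ∧ ∀ z ∈ K, Complex.exp (u z) = f z

theorem LogOn.congr {K : Set ℂ} {f g : ℂ → ℂ} (h : LogOn K f) (hfg : ∀ z ∈ K, f z = g z) :
    LogOn K g := by
  obtain ⟨u, hu, hu'⟩ := h
  exact ⟨u, hu, fun z hz => (hu' z hz).trans (hfg z hz)⟩

theorem LogOn.mono {K K' : Set ℂ} {f : ℂ → ℂ} (h : LogOn K f) (hK : K' ⊆ K) : LogOn K' f := by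
  obtain ⟨u, hu, hu'⟩ := h
  exact ⟨u, hu.mono hK, fun z hz => hu' z (hK hz)⟩

theorem LogOn.mul {K : Set ℂ} {f g : ℂ → ℂ} (hf : LogOn K f) (hg : LogOn K g) :
    LogOn K (fun z => f z * g z) := by
  obtain ⟨u, hu, hu'⟩ := hf
  obtain ⟨v, hv, hv'⟩ := hg
  exact ⟨fun z => u z + v z, hu.add hv, fun z hz => by
    simp only [Complex.exp_add, hu' z hz, hv' z hz]⟩

theorem LogOn.zpow {K : Set ℂ} {f : ℂ → ℂ} (hf : LogOn K f) (n : ℤ) :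
    LogOn K (fun z => f z ^ n) := by
  obtain ⟨u, hu, hu'⟩ := hf
  exact ⟨fun z => n * u z, continuousOn_const.mul hu, fun z hz => by
    simp only [Complex.exp_int_mul, hu' z hz]⟩

theorem LogOn.const {K : Set ℂ} {c : ℂ} (hc : c ≠ 0) : LogOn K (fun _ => c) :=
  ⟨fun _ => Complex.log c, continuousOn_const, fun _ _ => Complex.exp_log hc⟩

theorem LogOn.of_slit {K : Set ℂ} {f : ℂ → ℂ} (hf : ContinuousOn f K)
    (h : ∀ z ∈ K, f z ∈ Complex.slitPlane) : LogOn K f :=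
  ⟨fun z => Complex.log (f z), hf.clog h, fun z hz =>
    Complex.exp_log (Complex.slitPlane_ne_zero (h z hz))⟩

/-- The rational function `∏ (z - c)^k`. -/
def rat (T : Multiset (ℂ × ℤ)) (z : ℂ) : ℂ := (T.map fun c => (z - c.1) ^ c.2).prod

theorem rat_zero (z : ℂ) : rat 0 z = 1 := by simp [rat]

theorem rat_cons (c : ℂ × ℤ) (T : Multiset (ℂ × ℤ)) (z : ℂ) :
    rat (c ::ₘ T) z = (z - c.1) ^ c.2 * rat T z := by simp [rat]

theorem rat_add (T T' : Multiset (ℂ × ℤ)) (z : ℂ) :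
    rat (T + T') z = rat T z * rat T' z := by simp [rat]

theorem rat_filter (T : Multiset (ℂ × ℤ)) (P : ℂ × ℤ → Prop) [DecidablePred P] (z : ℂ) :
    rat (T.filter P) z * rat (T.filter fun c => ¬ P c) z = rat T z := by
  rw [← rat_add, Multiset.filter_add_not]

theorem rat_ne_zero (T : Multiset (ℂ × ℤ)) (z : ℂ) (h : ∀ c ∈ T, z ≠ c.1) : rat T z ≠ 0 := by
  unfold rat
  apply Multiset.prod_ne_zero
  intro hx
  obtain ⟨c, hc, h0⟩ := Multiset.mem_map.1 hx
  exact zpow_ne_zero _ (sub_ne_zero.2 (h c hc)) h0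

theorem rat_continuousOn (T : Multiset (ℂ × ℤ)) (K : Set ℂ) (h : ∀ c ∈ T, c.1 ∉ K) :
    ContinuousOn (rat T) K := by
  induction T using Multiset.induction_on with
  | empty => exact continuousOn_const.congr (fun z _ => rat_zero z)
  | cons c T ih =>
    have h1 : ContinuousOn (fun z : ℂ => (z - c.1) ^ c.2 * rat T z) K := by
      refine ContinuousOn.mul ?_ (ih fun c hc => h c (Multiset.mem_cons_of_mem hc))
      refine ContinuousOn.zpow₀ (by fun_prop) _ ?_
      intro z hz
      left
      rintro h0
      rw [sub_eq_zero.1 h0] at hz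
      exact h c (Multiset.mem_cons_self c T) hz
    exact h1.congr (fun z _ => rat_cons c T z)

theorem LogOn.rat {K : Set ℂ} (T : Multiset (ℂ × ℤ))
    (h : ∀ c ∈ T, LogOn K (fun z => z - c.1)) : LogOn K (rat T) := by
  induction T using Multiset.induction_on with
  | empty => exact (LogOn.const one_ne_zero).congr (fun z _ => (rat_zero z).symm)
  | cons c T ih =>
    exact (((h c (Multiset.mem_cons_self c T)).zpow c.2).mul
      (ih fun c hc => h c (Multiset.mem_cons_of_mem hc))).congr
      (fun z _ => (rat_cons c T z).symm)

/-- Interval gluing principle. -/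
theorem interval_glue (P : ℝ → ℝ → Prop)
    (hglue : ∀ x m y, x ≤ m → m ≤ y → P x m → P m y → P x y)
    (δ : ℝ) (hδ : 0 < δ) (hsmall : ∀ x y, x ≤ y → y - x ≤ δ → P x y) :
    ∀ x y, x ≤ y → P x y := by
  have key : ∀ n : ℕ, ∀ x y, x ≤ y → y - x ≤ n * δ → P x y := by
    intro n
    induction n with
    | zero =>
      intro x y h1 h2
      exact hsmall x y h1 (by simp at h2; linarith)
    | succ n ih =>
      intro x y h1 h2
      by_cases h3 : y - x ≤ δ
      · exact hsmall x y h1 h3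
      · push_cast at h2
        refine hglue x (x + δ) y (by linarith) (by linarith) (hsmall _ _ (by linarith) (by linarith))
          (ih _ _ (by linarith) (by linarith))
  intro x y h
  obtain ⟨n, hn⟩ := exists_nat_ge ((y - x) / δ)
  exact key n x y h ((div_le_iff₀ hδ).1 hn)

/-- Integer step functions. -/
def stepf (T : Multiset (ℝ × ℤ)) (y : ℝ) : ℤ := (T.map fun c => if y < c.1 then c.2 else 0).sum

theorem stepf_cons (c : ℝ × ℤ) (T : Multiset (ℝ × ℤ)) (y : ℝ) :
    stepf (c ::ₘ T) y = (if y < c.1 then c.2 else 0) + stepf T y := by simp [stepf]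

theorem stepf_add (T T' : Multiset (ℝ × ℤ)) (y : ℝ) :
    stepf (T + T') y = stepf T y + stepf T' y := by simp [stepf]

theorem stepf_filter (T : Multiset (ℝ × ℤ)) (P : ℝ × ℤ → Prop) [DecidablePred P] (z : ℝ) :
    stepf (T.filter P) z + stepf (T.filter fun c => ¬ P c) z = stepf T z := by
  rw [← stepf_add, Multiset.filter_add_not]

theorem stepf_eq_zero (T : Multiset (ℝ × ℤ)) (y : ℝ) (h : ∀ c ∈ T, c.1 ≤ y) : stepf T y = 0 := by
  unfold stepf
  apply Multiset.sum_eq_zero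
  intro x hx
  obtain ⟨c, hc, rfl⟩ := Multiset.mem_map.1 hx
  simp [not_lt.2 (h c hc)]

theorem stepf_eq_of_lt (T : Multiset (ℝ × ℤ)) (y y' : ℝ) (h : ∀ c ∈ T, y < c.1)
    (h' : ∀ c ∈ T, y' < c.1) : stepf T y = stepf T y' := by
  unfold stepf
  congr 1
  apply Multiset.map_congr rfl
  intro c hc
  rw [if_pos (h c hc), if_pos (h' c hc)]

theorem step_rep (J : Set ℝ) (hJ : IsCompact J) (d : ℝ → ℤ) (hd : ContinuousOn d J) :
    ∃ (T : Multiset (ℝ × ℤ)) (k : ℤ), (∀ c ∈ T, c.1 ∉ J) ∧ ∀ y ∈ J, d y = stepf T y + k := by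
  have huc := hJ.uniformContinuousOn_of_continuous hd
  rw [Metric.uniformContinuousOn_iff] at huc
  obtain ⟨δ, hδ, huc⟩ := huc 1 one_pos
  have hloc : ∀ x ∈ J, ∀ y ∈ J, |x - y| < δ → d x = d y := by
    intro x hx y hy hxy
    have := huc x hx y hy hxy
    rw [Int.dist_eq] at this
    have h2 : |d x - d y| < 1 := by exact_mod_cast this
    have := Int.abs_lt_one_iff.1 h2
    omega
  have key := interval_glue
    (fun x y => ∃ (T : Multiset (ℝ × ℤ)) (k : ℤ), (∀ c ∈ T, c.1 ∉ J) ∧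
      ∀ t ∈ J, x ≤ t → t ≤ y → d t = stepf T t + k) ?_ (δ / 2) (by linarith) ?_
  · obtain ⟨R, hR⟩ := hJ.isBounded.subset_closedBall 0
    obtain ⟨T, k, h1, h2⟩ := key (-|R|) |R| (by linarith [abs_nonneg R])
    refine ⟨T, k, h1, fun y hy => h2 y hy ?_ ?_⟩ <;>
    · have := hR hy
      rw [Metric.mem_closedBall, dist_zero_right, Real.norm_eq_abs] at this
      have := abs_le.1 this
      have := le_abs_self R
      linarith
  · rintro x m y hxm hmy ⟨T1, k1, hT1, h1⟩ ⟨T2, k2, hT2, h2⟩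
    have e1 : ∀ t, t ≤ m → stepf (T2.filter fun c => ¬ (c.1 ≤ m)) t
        = stepf (T2.filter fun c => ¬ (c.1 ≤ m)) m := by
      intro t ht
      apply stepf_eq_of_lt
      · intro c hc
        have := (Multiset.mem_filter.1 hc).2
        linarith
      · intro c hc
        have := (Multiset.mem_filter.1 hc).2
        linarith
    have e2 : ∀ t, m ≤ t → stepf (T2.filter fun c => (c.1 ≤ m)) t = 0 := by
      intro t ht
      apply stepf_eq_zero
      intro c hc
      have := (Multiset.mem_filter.1 hc).2
      linarith
    have e3 : ∀ t, m ≤ t → stepf (T1.filter fun c => (c.1 ≤ m)) t = 0 := by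
      intro t ht
      apply stepf_eq_zero
      intro c hc
      have := (Multiset.mem_filter.1 hc).2
      linarith
    have e4 : ∀ t, t ≤ m → stepf (T1.filter fun c => ¬ (c.1 ≤ m)) t
        = stepf (T1.filter fun c => ¬ (c.1 ≤ m)) m := by
      intro t ht
      apply stepf_eq_of_lt
      · intro c hc
        have := (Multiset.mem_filter.1 hc).2
        linarith
      · intro c hc
        have := (Multiset.mem_filter.1 hc).2
        linarith
    have f1 := fun t => stepf_filter T1 (fun c => c.1 ≤ m) t
    have f2 := fun t => stepf_filter T2 (fun c => c.1 ≤ m) t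
    by_cases hm : m ∈ J
    · refine ⟨T1.filter (fun c => c.1 ≤ m) + T2.filter (fun c => ¬ c.1 ≤ m), k2, ?_, ?_⟩
      · intro c hc
        rcases Multiset.mem_add.1 hc with h | h
        · exact hT1 c (Multiset.mem_filter.1 h).1
        · exact hT2 c (Multiset.mem_filter.1 h).1
      · intro t ht htx hty
        rw [stepf_add]
        have g1 := h1 m hm hxm le_rfl
        have g2 := h2 m hm le_rfl hmy
        have := f1 m
        have := f2 m
        have := e2 m le_rfl
        have := e3 m le_rfl
        have := f1 t
        have := f2 t
        rcases le_total t m with h | h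
        · have := h1 t ht htx h
          have := e1 t h
          have := e4 t h
          omega
        · have := h2 t ht h hty
          have := e2 t h
          have := e3 t h
          omega
    · refine ⟨(m, k1 + stepf (T1.filter fun c => ¬ (c.1 ≤ m)) m
          - k2 - stepf (T2.filter fun c => ¬ (c.1 ≤ m)) m) ::ₘ
          (T1.filter (fun c => c.1 ≤ m) + T2.filter (fun c => ¬ c.1 ≤ m)), k2, ?_, ?_⟩
      · intro c hc
        rcases Multiset.mem_cons.1 hc with rfl | hc
        · exact hm
        rcases Multiset.mem_add.1 hc with h | h
        · exact hT1 c (Multiset.mem_filter.1 h).1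
        · exact hT2 c (Multiset.mem_filter.1 h).1
      · intro t ht htx hty
        rw [stepf_cons, stepf_add]
        have := f1 t
        have := f2 t
        have htm : t ≠ m := fun h => hm (h ▸ ht)
        rcases lt_or_gt_of_ne htm with h | h
        · have := h1 t ht htx h.le
          have := e1 t h.le
          have := e4 t h.le
          simp only [h, if_true]
          omega
        · have := h2 t ht h.le hty
          have := e2 t h.le
          have := e3 t h.le
          simp only [not_lt.2 h.le, if_false]
          omega
  · intro x y hxy hsm
    by_cases hne : ∃ t ∈ J, x ≤ t ∧ t ≤ y
    · obtain ⟨t, ht, h1, h2⟩ := hne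
      refine ⟨0, d t, by simp, fun s hs h3 h4 => ?_⟩
      rw [hloc s hs t ht (by rw [abs_lt]; constructor <;> linarith)]
      simp [stepf]
    · refine ⟨0, 0, by simp, fun s hs h3 h4 => ?_⟩
      exact absurd ⟨s, hs, h3, h4⟩ hne
/-- Logarithm of `z - c` on the right closed half plane. -/
def lamR (ω c z : ℂ) : ℂ := Complex.log (ω * (z - c)) - Complex.log ω
/-- Logarithm of `z - c` on the left closed half plane. -/
def lamL (ω c z : ℂ) : ℂ := Complex.log (-(ω * (z - c))) - Complex.log ω + Real.pi * Complex.I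

theorem slit_of_re_nonneg {w : ℂ} (h : 0 ≤ w.re) (h0 : w ≠ 0) : w ∈ Complex.slitPlane := by
  rw [Complex.mem_slitPlane_iff]
  by_contra hcon
  push Not at hcon
  exact h0 (Complex.ext (le_antisymm hcon.1 h) hcon.2)

theorem lamR_cont (ω c : ℂ) (hω : ω ≠ 0) (K : Set ℂ) (hc : c ∉ K)
    (h : ∀ z ∈ K, (ω * c).re ≤ (ω * z).re) : ContinuousOn (lamR ω c) K := by
  unfold lamR
  refine ContinuousOn.sub (ContinuousOn.clog (by fun_prop) ?_) continuousOn_const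
  intro z hz
  apply slit_of_re_nonneg
  · rw [mul_sub, Complex.sub_re]
    linarith [h z hz]
  · exact mul_ne_zero hω (sub_ne_zero.2 (fun h => hc (h ▸ hz)))

theorem lamL_cont (ω c : ℂ) (hω : ω ≠ 0) (K : Set ℂ) (hc : c ∉ K)
    (h : ∀ z ∈ K, (ω * z).re ≤ (ω * c).re) : ContinuousOn (lamL ω c) K := by
  unfold lamL
  refine ContinuousOn.add (ContinuousOn.sub (ContinuousOn.clog (by fun_prop) ?_)
    continuousOn_const) continuousOn_const
  intro z hz
  apply slit_of_re_nonneg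
  · rw [mul_sub, Complex.neg_re, Complex.sub_re]
    linarith [h z hz]
  · exact neg_ne_zero.2 (mul_ne_zero hω (sub_ne_zero.2 (fun h => hc (h ▸ hz))))

theorem lamR_exp (ω c z : ℂ) (hω : ω ≠ 0) (hz : z ≠ c) : Complex.exp (lamR ω c z) = z - c := by
  unfold lamR
  rw [Complex.exp_sub, Complex.exp_log hω, Complex.exp_log (mul_ne_zero hω (sub_ne_zero.2 hz))]
  field_simp

theorem lamL_exp (ω c z : ℂ) (hω : ω ≠ 0) (hz : z ≠ c) : Complex.exp (lamL ω c z) = z - c := by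
  unfold lamL
  rw [Complex.exp_add, Complex.exp_sub, Complex.exp_log hω,
    Complex.exp_log (neg_ne_zero.2 (mul_ne_zero hω (sub_ne_zero.2 hz))), Complex.exp_pi_mul_I]
  field_simp

theorem lam_diff (ω c z : ℂ) (hω : ω ≠ 0) (hz : z ≠ c) (hre : (ω * z).re = (ω * c).re) :
    lamL ω c z - lamR ω c z =
      2 * Real.pi * Complex.I * ((if (ω * z).im < (ω * c).im then (1 : ℤ) else 0 : ℤ) : ℂ) := by
  unfold lamL lamR
  have hw : ω * (z - c) ≠ 0 := mul_ne_zero hω (sub_ne_zero.2 hz)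
  have him : (ω * (z - c)).im = (ω * z).im - (ω * c).im := by rw [mul_sub, Complex.sub_im]
  have hre' : (ω * (z - c)).re = 0 := by rw [mul_sub, Complex.sub_re]; linarith
  have him0 : (ω * (z - c)).im ≠ 0 := fun h => hw (Complex.ext hre' h)
  generalize ω * (z - c) = w at *
  rcases lt_or_gt_of_ne him0 with h | h
  · rw [if_pos (by linarith)]
    unfold Complex.log
    rw [norm_neg, Complex.arg_neg_eq_arg_add_pi_of_im_neg h]
    push_cast
    ring
  · rw [if_neg (by linarith)]
    unfold Complex.log
    rw [norm_neg, Complex.arg_neg_eq_arg_sub_pi_of_im_pos h]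
    push_cast
    ring

theorem logOn_right (ω c : ℂ) (hω : ω ≠ 0) (K : Set ℂ) (hc : c ∉ K)
    (h : ∀ z ∈ K, (ω * c).re ≤ (ω * z).re) : LogOn K (fun z => z - c) :=
  ⟨lamR ω c, lamR_cont ω c hω K hc h, fun z hz => lamR_exp ω c z hω (fun h => hc (h ▸ hz))⟩

theorem logOn_left (ω c : ℂ) (hω : ω ≠ 0) (K : Set ℂ) (hc : c ∉ K)
    (h : ∀ z ∈ K, (ω * z).re ≤ (ω * c).re) : LogOn K (fun z => z - c) :=
  ⟨lamL ω c, lamL_cont ω c hω K hc h, fun z hz => lamL_exp ω c z hω (fun h => hc (h ▸ hz))⟩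

/-- The point of the line `re (ω z) = a` with coordinate `y`. -/
def linePt (ω : ℂ) (a y : ℝ) : ℂ := ((a : ℂ) + y * Complex.I) / ω

theorem linePt_mul (ω : ℂ) (hω : ω ≠ 0) (a y : ℝ) :
    ω * linePt ω a y = (a : ℂ) + y * Complex.I := by
  unfold linePt
  field_simp

theorem linePt_re (ω : ℂ) (hω : ω ≠ 0) (a y : ℝ) : (ω * linePt ω a y).re = a := by
  rw [linePt_mul ω hω]; simp

theorem linePt_im (ω : ℂ) (hω : ω ≠ 0) (a y : ℝ) : (ω * linePt ω a y).im = y := by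
  rw [linePt_mul ω hω]; simp

theorem linePt_eq (ω : ℂ) (hω : ω ≠ 0) (a : ℝ) (z : ℂ) (hz : (ω * z).re = a) :
    linePt ω a (ω * z).im = z := by
  apply mul_left_cancel₀ hω
  apply Complex.ext
  · rw [linePt_re ω hω, hz]
  · rw [linePt_im ω hω]

theorem jump_logs (ω : ℂ) (hω : ω ≠ 0) (a : ℝ) (KL KR : Set ℂ)
    (hKL : ∀ z ∈ KL, (ω * z).re ≤ a) (hKR : ∀ z ∈ KR, a ≤ (ω * z).re)
    (T : Multiset (ℝ × ℤ)) (hTL : ∀ c ∈ T, linePt ω a c.1 ∉ KL)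
    (hTR : ∀ c ∈ T, linePt ω a c.1 ∉ KR) :
    ∃ ΛL ΛR : ℂ → ℂ, ContinuousOn ΛL KL ∧ ContinuousOn ΛR KR ∧
      (∀ z ∈ KL, Complex.exp (ΛL z) = rat (T.map fun c => (linePt ω a c.1, c.2)) z) ∧
      (∀ z ∈ KR, Complex.exp (ΛR z) = rat (T.map fun c => (linePt ω a c.1, c.2)) z) ∧
      ∀ z ∈ KL, z ∈ KR → ΛL z - ΛR z = 2 * Real.pi * Complex.I * (stepf T (ω * z).im : ℂ) := by
  induction T using Multiset.induction_on with
  | empty =>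
    exact ⟨fun _ => 0, fun _ => 0, continuousOn_const, continuousOn_const, by simp [rat],
      by simp [rat], by simp [stepf]⟩
  | cons c T ih =>
    obtain ⟨ΛL, ΛR, h1, h2, h3, h4, h5⟩ := ih (fun c hc => hTL c (Multiset.mem_cons_of_mem hc))
      (fun c hc => hTR c (Multiset.mem_cons_of_mem hc))
    have hcL := hTL c (Multiset.mem_cons_self c T)
    have hcR := hTR c (Multiset.mem_cons_self c T)
    have nL : ∀ z ∈ KL, z ≠ linePt ω a c.1 := fun z hz h => hcL (h ▸ hz)
    have nR : ∀ z ∈ KR, z ≠ linePt ω a c.1 := fun z hz h => hcR (h ▸ hz)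
    refine ⟨fun z => c.2 * lamL ω (linePt ω a c.1) z + ΛL z,
      fun z => c.2 * lamR ω (linePt ω a c.1) z + ΛR z, ?_, ?_, ?_, ?_, ?_⟩
    · refine (continuousOn_const.mul (lamL_cont ω _ hω KL hcL ?_)).add h1
      intro z hz
      rw [linePt_re ω hω]
      exact hKL z hz
    · refine (continuousOn_const.mul (lamR_cont ω _ hω KR hcR ?_)).add h2
      intro z hz
      rw [linePt_re ω hω]
      exact hKR z hz
    · intro z hz
      rw [Multiset.map_cons, rat_cons, Complex.exp_add, Complex.exp_int_mul,
        lamL_exp ω _ z hω (nL z hz), h3 z hz]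
    · intro z hz
      rw [Multiset.map_cons, rat_cons, Complex.exp_add, Complex.exp_int_mul,
        lamR_exp ω _ z hω (nR z hz), h4 z hz]
    · intro z hzL hzR
      have hre : (ω * z).re = (ω * linePt ω a c.1).re := by
        rw [linePt_re ω hω]
        exact le_antisymm (hKL z hzL) (hKR z hzR)
      have e1 := lam_diff ω _ z hω (nL z hzL) hre
      have e2 := h5 z hzL hzR
      rw [linePt_im ω hω] at e1
      rw [stepf_cons]
      have e3 : ((if (ω * z).im < c.1 then c.2 else 0 : ℤ) : ℂ)
          = c.2 * ((if (ω * z).im < c.1 then (1 : ℤ) else 0 : ℤ) : ℂ) := by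
        split_ifs <;> simp
      rw [Int.cast_add, e3]
      linear_combination c.2 * e1 + e2

/-- Functions which are, up to an exponential, rational with poles off `K`. -/
def Gd (K : Set ℂ) (s : ℂ → ℂ) : Prop :=
  ∃ T : Multiset (ℂ × ℤ), (∀ c ∈ T, c.1 ∉ K) ∧ LogOn K (fun z => s z * rat T z)

theorem two_pi_I_ne : (2 * Real.pi * Complex.I : ℂ) ≠ 0 := Complex.two_pi_I_ne_zero

theorem Gd.split (ω : ℂ) (hω : ω ≠ 0) (a : ℝ) (K : Set ℂ) (hK : IsCompact K) (s : ℂ → ℂ)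
    (hL : Gd (K ∩ {z | (ω * z).re ≤ a}) s) (hR : Gd (K ∩ {z | a ≤ (ω * z).re}) s) : Gd K s := by
  classical
  obtain ⟨TL, hTL, hL⟩ := hL
  obtain ⟨TR, hTR, hR⟩ := hR
  set KL := K ∩ {z | (ω * z).re ≤ a} with hKL
  set KR := K ∩ {z | a ≤ (ω * z).re} with hKR
  have hclL : IsClosed {z : ℂ | (ω * z).re ≤ a} := isClosed_le (by fun_prop) (by fun_prop)
  have hclR : IsClosed {z : ℂ | a ≤ (ω * z).re} := isClosed_le (by fun_prop) (by fun_prop)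
  have hKLc : IsClosed KL := hK.isClosed.inter hclL
  have hKRc : IsClosed KR := hK.isClosed.inter hclR
  set TL' := TL.filter (fun c => (ω * c.1).re < a) with hTL'
  set TR' := TR.filter (fun c => a < (ω * c.1).re) with hTR'
  have hL1 : LogOn KL (fun z => s z * rat (TL' + TR') z) := by
    have h1 : LogOn KL (rat (TL.filter (fun c => ¬ (ω * c.1).re < a))) := by
      apply LogOn.rat
      intro c hc
      obtain ⟨hc1, hc2⟩ := Multiset.mem_filter.1 hc
      exact logOn_left ω c.1 hω KL (hTL c hc1) (fun z hz => le_trans hz.2 (not_lt.1 hc2))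
    have h2 : LogOn KL (rat TR') := by
      apply LogOn.rat
      intro c hc
      obtain ⟨hc1, hc2⟩ := Multiset.mem_filter.1 hc
      exact logOn_left ω c.1 hω KL (fun h => absurd h.2 (not_le.2 hc2))
        (fun z hz => le_trans hz.2 hc2.le)
    refine ((hL.mul (h1.zpow (-1))).mul h2).congr ?_
    intro z hz
    have e := rat_filter TL (fun c => (ω * c.1).re < a) z
    have hne : rat (TL.filter (fun c => ¬ (ω * c.1).re < a)) z ≠ 0 := by
      apply rat_ne_zero
      intro c hc h
      exact hTL c (Multiset.mem_filter.1 hc).1 (h ▸ hz)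
    rw [rat_add, ← e, zpow_neg_one]
    field_simp
    ring
  have hR1 : LogOn KR (fun z => s z * rat (TL' + TR') z) := by
    have h1 : LogOn KR (rat (TR.filter (fun c => ¬ a < (ω * c.1).re))) := by
      apply LogOn.rat
      intro c hc
      obtain ⟨hc1, hc2⟩ := Multiset.mem_filter.1 hc
      exact logOn_right ω c.1 hω KR (hTR c hc1) (fun z hz => le_trans (not_lt.1 hc2) hz.2)
    have h2 : LogOn KR (rat TL') := by
      apply LogOn.rat
      intro c hc
      obtain ⟨hc1, hc2⟩ := Multiset.mem_filter.1 hc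
      exact logOn_right ω c.1 hω KR (fun h => absurd h.2 (not_le.2 hc2))
        (fun z hz => le_trans hc2.le hz.2)
    refine ((hR.mul (h1.zpow (-1))).mul h2).congr ?_
    intro z hz
    have e := rat_filter TR (fun c => a < (ω * c.1).re) z
    have hne : rat (TR.filter (fun c => ¬ a < (ω * c.1).re)) z ≠ 0 := by
      apply rat_ne_zero
      intro c hc h
      exact hTR c (Multiset.mem_filter.1 hc).1 (h ▸ hz)
    rw [rat_add, ← e, zpow_neg_one]
    field_simp
    ring
  have hpoles : ∀ c ∈ TL' + TR', c.1 ∉ K := by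
    intro c hc hcK
    rcases Multiset.mem_add.1 hc with h | h
    · obtain ⟨h1, h2⟩ := Multiset.mem_filter.1 h
      exact hTL c h1 ⟨hcK, h2.le⟩
    · obtain ⟨h1, h2⟩ := Multiset.mem_filter.1 h
      exact hTR c h1 ⟨hcK, h2.le⟩
  obtain ⟨uL, huL, huL'⟩ := hL1
  obtain ⟨uR, huR, huR'⟩ := hR1
  -- the jump
  set J : Set ℝ := (fun z : ℂ => (ω * z).im) '' (KL ∩ KR) with hJ
  have hJc : IsCompact J :=
    ((hK.inter_right hclL).inter_right hKRc).image (by fun_prop)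
  have hJmem : ∀ y, linePt ω a y ∈ KL ∩ KR ↔ y ∈ J := by
    intro y
    constructor
    · intro h
      exact ⟨_, h, linePt_im ω hω a y⟩
    · rintro ⟨z, hz, rfl⟩
      rw [linePt_eq ω hω a z (le_antisymm hz.1.2 hz.2.2)]
      exact hz
  have hdiffZ : ∀ z ∈ KL ∩ KR, ∃ n : ℤ, uR z - uL z = n * (2 * Real.pi * Complex.I) := by
    intro z hz
    rw [← Complex.exp_eq_one_iff, Complex.exp_sub, huL' z hz.1, huR' z hz.2, div_self]
    rw [← huL' z hz.1]
    exact Complex.exp_ne_zero _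
  set D : ℝ → ℝ := fun y => ((uR (linePt ω a y) - uL (linePt ω a y)) /
    (2 * Real.pi * Complex.I)).re with hD
  have hDi : ∀ y ∈ J, ((round (D y) : ℤ) : ℝ) = D y ∧
      uR (linePt ω a y) - uL (linePt ω a y) = (round (D y) : ℤ) * (2 * Real.pi * Complex.I) := by
    intro y hy
    obtain ⟨n, hn⟩ := hdiffZ _ ((hJmem y).2 hy)
    have : D y = n := by
      simp only [hD]
      rw [hn, mul_div_assoc, div_self two_pi_I_ne]
      simp
    rw [this, round_intCast]
    exact ⟨rfl, hn⟩
  have hlp : Continuous (linePt ω a) := by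
    unfold linePt
    fun_prop
  have hDc : ContinuousOn D J := by
    have m1 : Set.MapsTo (linePt ω a) J KL := fun y hy => ((hJmem y).2 hy).1
    have m2 : Set.MapsTo (linePt ω a) J KR := fun y hy => ((hJmem y).2 hy).2
    refine Complex.continuous_re.comp_continuousOn (ContinuousOn.div_const (ContinuousOn.sub ?_ ?_) _)
    · exact huR.comp hlp.continuousOn m2
    · exact huL.comp hlp.continuousOn m1
  have hdc : ContinuousOn (fun y => round (D y)) J := by
    rw [Int.isClosedEmbedding_coe_real.isEmbedding.continuousOn_iff]
    exact hDc.congr (fun y hy => (hDi y hy).1)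
  obtain ⟨T, k, hT, hTd⟩ := step_rep J hJc _ hdc
  have hline : ∀ c ∈ T, linePt ω a c.1 ∉ K := by
    intro c hc h
    apply hT c hc
    rw [← hJmem]
    exact ⟨⟨h, (linePt_re ω hω a c.1).le⟩, ⟨h, (linePt_re ω hω a c.1).ge⟩⟩
  obtain ⟨ΛL, ΛR, h1, h2, h3, h4, h5⟩ := jump_logs ω hω a KL KR (fun z hz => hz.2)
    (fun z hz => hz.2) T (fun c hc h => hline c hc h.1) (fun c hc h => hline c hc h.1)
  set TJ := T.map fun c => (linePt ω a c.1, c.2) with hTJ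
  refine ⟨TL' + TR' + TJ, ?_, ?_⟩
  · intro c hc
    rcases Multiset.mem_add.1 hc with h | h
    · exact hpoles c h
    · obtain ⟨c', hc', rfl⟩ := Multiset.mem_map.1 h
      exact hline c' hc'
  · have hcov : K = KL ∪ KR := by
      rw [hKL, hKR, ← Set.inter_union_distrib_left]
      refine (Set.inter_eq_left.2 ?_).symm
      intro z _
      exact le_total (ω * z).re a
    set vL : ℂ → ℂ := fun z => uL z + ΛL z with hvL
    set vR : ℂ → ℂ := fun z => uR z + ΛR z - k * (2 * Real.pi * Complex.I) with hvR
    have hag : ∀ z ∈ KL, z ∈ KR → vL z = vR z := by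
      intro z hz1 hz2
      have hz : (ω * z).re = a := le_antisymm hz1.2 hz2.2
      have hy : (ω * z).im ∈ J := ⟨z, ⟨hz1, hz2⟩, rfl⟩
      have e1 := (hDi _ hy).2
      have e2 := hTd _ hy
      rw [e2, linePt_eq ω hω a z hz] at e1
      have e3 := h5 z hz1 hz2
      simp only [hvL, hvR]
      push_cast at e1
      linear_combination e3 - e1
    have hexL : ∀ z ∈ KL, Complex.exp (vL z) = s z * rat (TL' + TR' + TJ) z := by
      intro z hz
      simp only [hvL]
      rw [Complex.exp_add, huL' z hz, h3 z hz, rat_add _ TJ]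
      ring
    have hexR : ∀ z ∈ KR, Complex.exp (vR z) = s z * rat (TL' + TR' + TJ) z := by
      intro z hz
      simp only [hvR]
      rw [Complex.exp_sub, Complex.exp_int_mul_two_pi_mul_I, Complex.exp_add, huR' z hz,
        h4 z hz, rat_add _ TJ]
      ring
    refine ⟨fun z => if (ω * z).re ≤ a then vL z else vR z, ?_, ?_⟩
    · rw [hcov]
      apply ContinuousOn.union_of_isClosed _ _ hKLc hKRc
      · refine (huL.add h1).congr ?_
        intro z hz
        simp only
        have h : (ω * z).re ≤ a := hz.2
        rw [if_pos h]
        rfl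
      · refine ((huR.add h2).sub continuousOn_const).congr
          (f := fun z => vR z) ?_
        intro z hz
        simp only
        split_ifs with h
        · exact hag z ⟨hz.1, h⟩ hz
        · rfl
    · intro z hz
      simp only
      split_ifs with h
      · exact hexL z ⟨hz, h⟩
      · exact hexR z ⟨hz, (not_le.1 h).le⟩

theorem Gd.all (K : Set ℂ) (hK : IsCompact K) (s : ℂ → ℂ) (hs : ContinuousOn s K)
    (hs0 : ∀ z ∈ K, s z ≠ 0) : Gd K s := by
  -- small pieces
  have hsmall : ∃ δ > 0, ∀ K' ⊆ K, (∀ x ∈ K', ∀ y ∈ K', dist x y < δ) → Gd K' s := by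
    rcases K.eq_empty_or_nonempty with rfl | hne
    · refine ⟨1, one_pos, fun K' hK' _ => ?_⟩
      rw [Set.subset_empty_iff.1 hK']
      exact ⟨0, by simp, fun _ => 0, continuousOn_empty _, by simp⟩
    obtain ⟨z0, hz0, hmin⟩ := hK.exists_isMinOn hne hs.norm
    have hpos : 0 < ‖s z0‖ := norm_pos_iff.2 (hs0 z0 hz0)
    have huc := hK.uniformContinuousOn_of_continuous hs
    rw [Metric.uniformContinuousOn_iff] at huc
    obtain ⟨δ, hδ, huc⟩ := huc _ hpos
    refine ⟨δ, hδ, fun K' hK' hd => ⟨0, by simp, ?_⟩⟩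
    rcases K'.eq_empty_or_nonempty with rfl | ⟨w, hw⟩
    · exact ⟨fun _ => 0, continuousOn_empty _, by simp⟩
    have hw0 := hs0 w (hK' hw)
    have h1 : LogOn K' (fun z => s z / s w) := by
      apply LogOn.of_slit ((hs.mono hK').div_const _)
      intro z hz
      have h2 := huc z (hK' hz) w (hK' hw) (hd z hz w hw)
      have h3 : ‖s z0‖ ≤ ‖s w‖ := hmin (hK' hw)
      have h4 : s z / s w = 1 + (s z - s w) / s w := by field_simp; ring
      rw [h4]
      apply Complex.mem_slitPlane_of_norm_lt_one
      rw [norm_div, div_lt_one (by linarith), ← dist_eq_norm]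
      linarith
    refine (h1.mul (LogOn.const hw0)).congr ?_
    intro z hz
    rw [rat_zero]
    field_simp
  obtain ⟨δ, hδ, hsmall⟩ := hsmall
  obtain ⟨R, hR⟩ := hK.isBounded.subset_closedBall 0
  have hRr : ∀ z ∈ K, |z.re| ≤ |R| ∧ |z.im| ≤ |R| := by
    intro z hz
    have := hR hz
    rw [Metric.mem_closedBall, dist_zero_right] at this
    exact ⟨((Complex.abs_re_le_norm z).trans this).trans (le_abs_self R),
      ((Complex.abs_im_le_norm z).trans this).trans (le_abs_self R)⟩
  have hcomp : ∀ x y x' y' : ℝ,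
      IsCompact (K ∩ {z : ℂ | x ≤ z.re ∧ z.re ≤ y ∧ x' ≤ z.im ∧ z.im ≤ y'}) := by
    intro x y x' y'
    apply hK.inter_right
    exact (isClosed_le continuous_const Complex.continuous_re).inter
      ((isClosed_le Complex.continuous_re continuous_const).inter
      ((isClosed_le continuous_const Complex.continuous_im).inter
      (isClosed_le Complex.continuous_im continuous_const)))
  have key := interval_glue (fun x y => ∀ x' y' : ℝ, x' ≤ y' →
    Gd (K ∩ {z : ℂ | x ≤ z.re ∧ z.re ≤ y ∧ x' ≤ z.im ∧ z.im ≤ y'}) s) ?_ (δ / 4) (by linarith) ?_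
  · have := key (-|R|) |R| (by linarith [abs_nonneg R]) (-|R|) |R| (by linarith [abs_nonneg R])
    rwa [Set.inter_eq_left.2] at this
    intro z hz
    have := hRr z hz
    rw [abs_le, abs_le] at this
    exact ⟨this.1.1, this.1.2, this.2.1, this.2.2⟩
  · intro x m y hxm hmy h1 h2 x' y' hxy'
    apply Gd.split 1 one_ne_zero m _ (hcomp _ _ _ _)
    · convert h1 x' y' hxy' using 1
      ext z
      simp only [Set.mem_inter_iff, Set.mem_ofPred_eq, one_mul]
      constructor
      · rintro ⟨⟨h, h1, h2, h3, h4⟩, h5⟩; exact ⟨h, h1, h5, h3, h4⟩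
      · rintro ⟨h, h1, h5, h3, h4⟩; exact ⟨⟨h, h1, h5.trans hmy, h3, h4⟩, h5⟩
    · convert h2 x' y' hxy' using 1
      ext z
      simp only [Set.mem_inter_iff, Set.mem_ofPred_eq, one_mul]
      constructor
      · rintro ⟨⟨h, h1, h2, h3, h4⟩, h5⟩; exact ⟨h, h5, h2, h3, h4⟩
      · rintro ⟨h, h1, h5, h3, h4⟩; exact ⟨⟨h, hxm.trans h1, h5, h3, h4⟩, h1⟩
  · intro x y hxy hsm
    apply interval_glue (fun x' y' =>
      Gd (K ∩ {z : ℂ | x ≤ z.re ∧ z.re ≤ y ∧ x' ≤ z.im ∧ z.im ≤ y'}) s) _ (δ / 4) (by linarith)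
    · intro x' y' hxy' hsm'
      apply hsmall _ Set.inter_subset_left
      rintro z ⟨-, hz1, hz2, hz3, hz4⟩ w ⟨-, hw1, hw2, hw3, hw4⟩
      rw [dist_eq_norm]
      refine (Complex.norm_le_abs_re_add_abs_im _).trans_lt ?_
      have e1 : |(z - w).re| ≤ δ / 4 := by
        rw [Complex.sub_re, abs_le]; constructor <;> linarith
      have e2 : |(z - w).im| ≤ δ / 4 := by
        rw [Complex.sub_im, abs_le]; constructor <;> linarith
      linarith
    · intro x' m y' hxm hmy h1 h2
      have hI : (-Complex.I) ≠ 0 := neg_ne_zero.2 Complex.I_ne_zero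
      apply Gd.split (-Complex.I) hI m _ (hcomp _ _ _ _)
      · convert h1 using 1
        ext z
        simp only [Set.mem_inter_iff, Set.mem_ofPred_eq]
        have : (-Complex.I * z).re = z.im := by simp
        rw [this]
        constructor
        · rintro ⟨⟨h, h1, h2, h3, h4⟩, h5⟩; exact ⟨h, h1, h2, h3, h5⟩
        · rintro ⟨h, h1, h2, h3, h4⟩; exact ⟨⟨h, h1, h2, h3, h4.trans hmy⟩, h4⟩
      · convert h2 using 1
        ext z
        simp only [Set.mem_inter_iff, Set.mem_ofPred_eq]
        have : (-Complex.I * z).re = z.im := by simp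
        rw [this]
        constructor
        · rintro ⟨⟨h, h1, h2, h3, h4⟩, h5⟩; exact ⟨h, h1, h2, h5, h4⟩
        · rintro ⟨h, h1, h2, h3, h4⟩; exact ⟨⟨h, h1, h2, hxm.trans h3, h4⟩, h3⟩
theorem const_of_exp {X : Type*} [TopologicalSpace X] [PreconnectedSpace X] (f g : X → ℂ)
    (hf : Continuous f) (hg : Continuous g) (h : ∀ x, Complex.exp (f x) = Complex.exp (g x))
    (x y : X) : f x - g x = f y - g y := by
  have key : f = fun t => g t + (f y - g y) := by
    apply Complex.isCoveringMap_exp.eq_of_comp_eq hf (by fun_prop) _ y (by ring)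
    funext t
    apply Subtype.ext
    simp only [Function.comp]
    rw [Complex.exp_add, Complex.exp_sub, h y, div_self (Complex.exp_ne_zero _), mul_one, h t]
  have := congrFun key x
  rw [this]
  ring

theorem exists_log {X : Type*} [TopologicalSpace X] [SimplyConnectedSpace X]
    [LocallyPathConnectedSpace X] [Nonempty X] (f : X → ℂ) (hf : Continuous f)
    (h0 : ∀ x, f x ≠ 0) :
    ∃ L : X → ℂ, Continuous L ∧ ∀ x, Complex.exp (L x) = f x := by
  obtain ⟨x0⟩ := ‹Nonempty X›
  obtain ⟨F, ⟨-, hF⟩, -⟩ := Complex.isCoveringMapOn_exp.existsUnique_continuousMap_lifts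
    ⟨f, hf⟩ (a₀ := x0) (Complex.exp_log (h0 x0)) (fun x => h0 x)
  exact ⟨F, F.continuous, fun x => congrFun hF x⟩

theorem circle_pow (R : ℝ) (hR : 0 < R) (N : ℤ)
    (h : LogOn (Metric.sphere (0 : ℂ) R) (fun z => z ^ N)) : N = 0 := by
  obtain ⟨u, hu, hu'⟩ := h
  set c : ℝ → ℂ := fun θ => R * Complex.exp (θ * Complex.I) with hc
  have hcm : ∀ θ, c θ ∈ Metric.sphere (0 : ℂ) R := by
    intro θ
    simp only [hc, mem_sphere_zero_iff_norm, norm_mul, Complex.norm_exp_ofReal_mul_I]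
    simp [abs_of_pos hR]
  have hcc : Continuous c := by fun_prop
  have huc : Continuous (fun θ => u (c θ)) := hu.comp_continuous hcc hcm
  have hR0 : (R : ℂ) ≠ 0 := by exact_mod_cast hR.ne'
  have e := const_of_exp (fun θ => u (c θ)) (fun θ => N * (Complex.log R + θ * Complex.I)) huc
    (by fun_prop) (by
      intro θ
      rw [hu' _ (hcm θ), Complex.exp_int_mul, Complex.exp_add, Complex.exp_log hR0])
    (2 * Real.pi) 0
  have hcp : c (2 * Real.pi) = c 0 := by
    simp only [hc]
    push_cast
    rw [Complex.exp_two_pi_mul_I]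
    simp
  simp only [hcp] at e
  have e2 : (N : ℂ) * (2 * Real.pi * Complex.I) = 0 := by
    push_cast at e
    linear_combination -e
  rcases mul_eq_zero.1 e2 with h | h
  · exact_mod_cast h
  · exact absurd h two_pi_I_ne

theorem rat_circle (R : ℝ) (T : Multiset (ℂ × ℤ)) (h : ∀ c ∈ T, ‖c.1‖ < R) (hR : 0 < R) :
    ∃ k : ℤ, LogOn (Metric.sphere (0 : ℂ) R) (fun z => rat T z * z ^ k) := by
  induction T using Multiset.induction_on with
  | empty => exact ⟨0, (LogOn.const one_ne_zero).congr (fun z _ => by simp [rat])⟩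
  | cons c T ih =>
    obtain ⟨k, hk⟩ := ih (fun c hc => h c (Multiset.mem_cons_of_mem hc))
    have hc := h c (Multiset.mem_cons_self c T)
    have hz0 : ∀ z ∈ Metric.sphere (0 : ℂ) R, z ≠ 0 := by
      rintro z hz rfl
      simp at hz
      exact hR.ne hz
    have h1 : LogOn (Metric.sphere (0 : ℂ) R) (fun z => 1 + (- c.1 / z)) := by
      apply LogOn.of_slit
      · exact continuousOn_const.add (continuousOn_const.div continuousOn_id hz0)
      · intro z hz
        apply Complex.mem_slitPlane_of_norm_lt_one
        rw [mem_sphere_zero_iff_norm] at hz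
        rw [norm_div, norm_neg, hz, div_lt_one hR]
        exact hc
    refine ⟨k - c.2, (hk.mul (h1.zpow c.2)).congr ?_⟩
    intro z hz
    have hz0 := hz0 z hz
    have e : 1 + (- c.1 / z) = (z - c.1) / z := by field_simp; ring
    rw [rat_cons, e, div_zpow, zpow_sub₀ hz0]
    ring

theorem comp_union_closed (K : Set ℂ) (hK : IsClosed K) (p : ℂ) :
    IsClosed (connectedComponentIn Kᶜ p ∪ K) := by
  rw [← isOpen_compl_iff, isOpen_iff_mem_nhds]
  intro x hx
  have hxK : x ∈ Kᶜ := fun h => hx (Or.inr h)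
  have hxD : x ∉ connectedComponentIn Kᶜ p := fun h => hx (Or.inl h)
  have ho : IsOpen (connectedComponentIn Kᶜ x) := hK.isOpen_compl.connectedComponentIn
  refine Filter.mem_of_superset (ho.mem_nhds (mem_connectedComponentIn hxK)) ?_
  rintro y hy (h | h)
  · apply hxD
    rw [connectedComponentIn_eq h, ← connectedComponentIn_eq hy]
    exact mem_connectedComponentIn hxK
  · exact connectedComponentIn_subset _ _ hy h

theorem tietze_on (K : Set ℂ) (hK : IsClosed K) (u : ℂ → ℂ) (hu : ContinuousOn u K) :
    ∃ v : ℂ → ℂ, Continuous v ∧ ∀ z ∈ K, v z = u z := by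
  obtain ⟨g, hg⟩ := ContinuousMap.exists_restrict_eq hK
    (⟨K.domRestrict u, continuousOn_iff_continuous_domRestrict.1 hu⟩ : C(K, ℂ))
  exact ⟨g, g.continuous, fun z hz => DFunLike.congr_fun hg ⟨z, hz⟩⟩

theorem plane_key (K : Set ℂ) (hK : IsCompact K) (p q : ℂ) (hp : p ∉ K) (hq : q ∉ K)
    (hb : Bornology.IsBounded (connectedComponentIn Kᶜ p)) (hqD : q ∉ connectedComponentIn Kᶜ p)
    (s : ℂ → ℂ) (hs : ContinuousOn s K) (hsq : ∀ z ∈ K, s z ^ 2 * (z - q) = z - p) : False := by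
  classical
  have hs0 : ∀ z ∈ K, s z ≠ 0 := by
    intro z hz h
    have := hsq z hz
    rw [h] at this
    apply hp
    have h2 : z - p = 0 := by rw [← this]; ring
    rwa [← sub_eq_zero.1 h2]
  obtain ⟨T, hT, u, hu, hu'⟩ := Gd.all K hK s hs hs0
  obtain ⟨v, hv, hvu⟩ := tietze_on K hK.isClosed u hu
  set D := connectedComponentIn Kᶜ p with hD
  have hpD : p ∈ D := mem_connectedComponentIn hp
  have hDo : IsOpen D := hK.isClosed.isOpen_compl.connectedComponentIn
  have hDK : ∀ z ∈ D, z ∉ K := fun z hz => connectedComponentIn_subset _ _ hz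
  set T1 := T.filter (fun c => c.1 ∈ D) with hT1
  set T2 := T.filter (fun c => ¬ c.1 ∈ D) with hT2
  have hT1D : ∀ c ∈ T1, c.1 ∈ D := fun c hc => (Multiset.mem_filter.1 hc).2
  have hT2D : ∀ c ∈ T2, c.1 ∉ D ∪ K := fun c hc h => by
    obtain ⟨h1, h2⟩ := Multiset.mem_filter.1 hc
    rcases h with h | h
    · exact h2 h
    · exact hT c h1 h
  have hprod : ∀ z, rat T1 z * rat T2 z = rat T z := fun z => rat_filter T _ z
  set A : ℂ → ℂ := fun z => Complex.exp (2 * v z) * (z - q) * (rat T2 z ^ 2)⁻¹ with hA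
  set B : ℂ → ℂ := fun z => (z - p) * rat T1 z ^ 2 with hB
  have n2 : ∀ z ∈ D ∪ K, rat T2 z ≠ 0 := fun z hz =>
    rat_ne_zero _ _ (fun c hc h => hT2D c hc (h ▸ hz))
  have n1 : ∀ z ∈ Dᶜ, rat T1 z ≠ 0 := fun z hz =>
    rat_ne_zero _ _ (fun c hc h => hz (h ▸ hT1D c hc))
  have hAB : ∀ z ∈ K, A z = B z := by
    intro z hz
    have e1 : Complex.exp (u z) = s z * rat T z := hu' z hz
    have e2 := hsq z hz
    have e3 := hprod z
    have e4 := n2 z (Or.inr hz)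
    simp only [hA, hB]
    rw [hvu z hz, two_mul, Complex.exp_add, e1, ← e2, ← e3]
    field_simp
  have hAc : ContinuousOn A (D ∪ K) := by
    have := rat_continuousOn T2 (D ∪ K) hT2D
    refine ContinuousOn.mul (by fun_prop) (ContinuousOn.inv₀ (this.pow 2) ?_)
    intro z hz
    exact pow_ne_zero 2 (n2 z hz)
  have hBc : ContinuousOn B Dᶜ := by
    have := rat_continuousOn T1 Dᶜ (fun c hc h => h (hT1D c hc))
    exact ContinuousOn.mul (by fun_prop) (this.pow 2)
  set G : ℂ → ℂ := fun z => if z ∈ D then A z else B z with hG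
  have hGA : ∀ z ∈ D ∪ K, G z = A z := by
    intro z hz
    simp only [hG]
    split_ifs with h
    · rfl
    · exact (hAB z (hz.resolve_left h)).symm
  have hGB : ∀ z ∈ Dᶜ, G z = B z := by
    intro z hz
    simp only [hG]
    rw [if_neg hz]
  have hGc : Continuous G := by
    rw [← continuousOn_univ]
    have : (Set.univ : Set ℂ) = (D ∪ K) ∪ Dᶜ := by
      ext z
      by_cases h : z ∈ D <;> simp [h]
    rw [this]
    exact (hAc.congr hGA).union_of_isClosed (hBc.congr hGB)
      (comp_union_closed K hK.isClosed p) hDo.isClosed_compl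
  have hG0 : ∀ z, G z ≠ 0 := by
    intro z
    by_cases h : z ∈ D
    · rw [hGA z (Or.inl h)]
      refine mul_ne_zero (mul_ne_zero (Complex.exp_ne_zero _) (sub_ne_zero.2 ?_))
        (inv_ne_zero (pow_ne_zero 2 (n2 z (Or.inl h))))
      rintro rfl
      exact hqD h
    · rw [hGB z h]
      refine mul_ne_zero (sub_ne_zero.2 ?_) (pow_ne_zero 2 (n1 z h))
      rintro rfl
      exact h hpD
  obtain ⟨M, hM, hM'⟩ := exists_log G hGc hG0
  obtain ⟨R0, hR0⟩ := hb.subset_closedBall 0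
  set R := |R0| + 1 with hR
  have hRpos : 0 < R := by positivity
  have hDR : ∀ z ∈ D, ‖z‖ < R := by
    intro z hz
    have := hR0 hz
    rw [mem_closedBall_zero_iff] at this
    have := le_abs_self R0
    linarith
  obtain ⟨k, hk⟩ := rat_circle R T1 (fun c hc => hDR _ (hT1D c hc)) hRpos
  have hp1 : LogOn (Metric.sphere (0 : ℂ) R) (fun z => 1 + (- p / z)) := by
    apply LogOn.of_slit
    · refine continuousOn_const.add (continuousOn_const.div continuousOn_id ?_)
      rintro z hz rfl
      simp at hz
      exact hRpos.ne hz
    · intro z hz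
      apply Complex.mem_slitPlane_of_norm_lt_one
      rw [mem_sphere_zero_iff_norm] at hz
      rw [norm_div, norm_neg, hz, div_lt_one hRpos]
      exact hDR p hpD
  have hMlog : LogOn (Metric.sphere (0 : ℂ) R) B := by
    refine ⟨M, hM.continuousOn, fun z hz => ?_⟩
    rw [hM', hGB]
    intro h
    have := hDR z h
    rw [mem_sphere_zero_iff_norm] at hz
    linarith
  have hfin : LogOn (Metric.sphere (0 : ℂ) R) (fun z => z ^ (1 - 2 * k)) := by
    refine ((hMlog.mul (hp1.zpow (-1))).mul (hk.zpow (-2))).congr ?_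
    intro z hz
    rw [mem_sphere_zero_iff_norm] at hz
    have hz0 : z ≠ 0 := by
      rintro rfl
      simp at hz
      exact hRpos.ne hz
    have hzD : z ∉ D := fun h => by
      have := hDR z h
      linarith
    have hzp : z - p ≠ 0 := by
      rw [sub_ne_zero]
      rintro rfl
      exact hzD hpD
    have h1 := n1 z hzD
    have e : 1 + (- p / z) = (z - p) / z := by field_simp; ring
    have hzk := zpow_ne_zero k hz0
    have e2 : z ^ (1 - 2 * k) = z * ((z ^ k) ^ 2)⁻¹ := by
      rw [zpow_sub₀ hz0, zpow_one, mul_comm 2 k, zpow_mul]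
      norm_cast
    have e3 : (rat T1 z * z ^ k) ^ (-2 : ℤ) = ((rat T1 z * z ^ k) ^ 2)⁻¹ := by
      rw [zpow_neg]
      norm_cast
    rw [e, e2, e3, zpow_neg_one]
    simp only [hB]
    field_simp
  have := circle_pow R hRpos _ hfin
  omega
theorem exists_log_I (f : unitInterval → ℂ) (hf : Continuous f) (h0 : ∀ x, f x ≠ 0) :
    ∃ L : unitInterval → ℂ, Continuous L ∧ ∀ x, Complex.exp (L x) = f x := by
  obtain ⟨L, hL, hL'⟩ := exists_log (fun x : ℝ => f (Set.projIcc 0 1 zero_le_one x))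
    (hf.comp continuous_projIcc) (fun x => h0 _)
  refine ⟨fun t => L t, hL.comp continuous_subtype_val, fun t => ?_⟩
  rw [hL', Set.projIcc_val]

/-- `w` is the variation of a continuous logarithm of `f`. -/
def IsVar (f : unitInterval → ℂ) (w : ℂ) : Prop :=
  ∃ L : unitInterval → ℂ, Continuous L ∧ (∀ t, Complex.exp (L t) = f t) ∧ w = L 1 - L 0

theorem IsVar.unique {f : unitInterval → ℂ} {w w' : ℂ} (h : IsVar f w) (h' : IsVar f w') :
    w = w' := by
  obtain ⟨L, hL, hL', rfl⟩ := h
  obtain ⟨M, hM, hM', rfl⟩ := h'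
  have := const_of_exp L M hL hM (fun t => by rw [hL', hM']) 1 0
  linear_combination this

theorem IsVar.mul {f g : unitInterval → ℂ} {w w' : ℂ} (h : IsVar f w) (h' : IsVar g w') :
    IsVar (fun t => f t * g t) (w + w') := by
  obtain ⟨L, hL, hL', rfl⟩ := h
  obtain ⟨M, hM, hM', rfl⟩ := h'
  exact ⟨fun t => L t + M t, hL.add hM, fun t => by rw [Complex.exp_add, hL', hM'], by ring⟩

/-- The parity of the total variation of the argument of `s` along the edges. -/
def Par {V : Type*} [Fintype V] (G : SimpleGraph V) [DecidableRel G.Adj] (idx : V → ℕ)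
    (pos : V → ℂ) (arcs : ∀ u v : V, G.Adj u v → unitInterval → ℂ) (s : ℂ → ℂ) (n : ZMod 2) :
    Prop :=
  ∃ (ℓ : V → ℂ) (m : V → V → ℤ), (∀ v, Complex.exp (ℓ v) = s (pos v)) ∧
    (∀ u v (h : G.Adj u v), idx u < idx v →
      IsVar (fun t => s (arcs u v h t)) (ℓ v - ℓ u + m u v * (2 * Real.pi * Complex.I))) ∧
    n = ∑ u, ∑ v, if G.Adj u v ∧ idx u < idx v then (m u v : ZMod 2) else 0

section
variable {V : Type*} [Fintype V] {G : SimpleGraph V} [DecidableRel G.Adj] {idx : V → ℕ}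
    {pos : V → ℂ} {arcs : ∀ u v : V, G.Adj u v → unitInterval → ℂ} {s s' : ℂ → ℂ} {n n' : ZMod 2}

theorem Par.mul (h : Par G idx pos arcs s n) (h' : Par G idx pos arcs s' n') :
    Par G idx pos arcs (fun z => s z * s' z) (n + n') := by
  obtain ⟨ℓ, m, h1, h2, rfl⟩ := h
  obtain ⟨ℓ', m', h1', h2', rfl⟩ := h'
  refine ⟨fun v => ℓ v + ℓ' v, fun u v => m u v + m' u v, ?_, ?_, ?_⟩
  · intro v
    rw [Complex.exp_add, h1, h1']
  · intro u v h huv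
    convert (h2 u v h huv).mul (h2' u v h huv) using 1
    push_cast
    ring
  · rw [← Finset.sum_add_distrib]
    refine Finset.sum_congr rfl fun u _ => ?_
    rw [← Finset.sum_add_distrib]
    refine Finset.sum_congr rfl fun v _ => ?_
    split_ifs <;> simp

theorem Par.congr (h : Par G idx pos arcs s n) (h1 : ∀ v, s (pos v) = s' (pos v))
    (h2 : ∀ u v h t, idx u < idx v → s (arcs u v h t) = s' (arcs u v h t)) :
    Par G idx pos arcs s' n := by
  obtain ⟨ℓ, m, h3, h4, h5⟩ := h
  refine ⟨ℓ, m, fun v => (h3 v).trans (h1 v), fun u v h huv => ?_, h5⟩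
  have e : (fun t => s' (arcs u v h t)) = fun t => s (arcs u v h t) :=
    funext fun t => (h2 u v h t huv).symm
  rw [e]
  exact h4 u v h huv

theorem even_sum (hidx : Function.Injective idx) (heven : ∀ v : V, Even (G.degree v))
    (k : V → ZMod 2) :
    (∑ u, ∑ v, if G.Adj u v ∧ idx u < idx v then k v - k u else 0) = 0 := by
  have e1 : (∑ u, ∑ v, if G.Adj u v ∧ idx u < idx v then k v - k u else 0)
      = (∑ u, ∑ v, if G.Adj u v ∧ idx u < idx v then k v else 0)
        + ∑ u, ∑ v, if G.Adj u v ∧ idx u < idx v then k u else 0 := by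
    rw [← Finset.sum_add_distrib]
    refine Finset.sum_congr rfl fun u _ => ?_
    rw [← Finset.sum_add_distrib]
    refine Finset.sum_congr rfl fun v _ => ?_
    split_ifs
    · rw [sub_eq_add_neg, ZMod.neg_eq_self_mod_two]
    · simp
  rw [e1, Finset.sum_comm, ← Finset.sum_add_distrib]
  refine Finset.sum_eq_zero fun u _ => ?_
  rw [← Finset.sum_add_distrib]
  have e2 : ∀ v, ((if G.Adj v u ∧ idx v < idx u then k u else 0)
      + if G.Adj u v ∧ idx u < idx v then k u else 0) = if G.Adj u v then k u else 0 := by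
    intro v
    by_cases h : G.Adj u v
    · have hne : idx u ≠ idx v := fun e => h.ne (hidx e)
      rcases lt_or_gt_of_ne hne with h' | h'
      · simp [h, h', h'.le]
      · simp [h, h.symm, h', h'.le]
    · have : ¬ G.Adj v u := fun h' => h h'.symm
      simp [h, this]
  rw [Finset.sum_congr rfl fun v _ => e2 v, ← Finset.sum_filter, Finset.sum_const,
    ← SimpleGraph.neighborFinset_eq_filter, SimpleGraph.card_neighborFinset_eq_degree]
  obtain ⟨r, hr⟩ := heven u
  rw [hr, ← two_mul, mul_smul, two_smul]
  exact CharTwo.add_self_eq_zero _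

theorem Par.unique (hidx : Function.Injective idx) (heven : ∀ v : V, Even (G.degree v))
    (h : Par G idx pos arcs s n) (h' : Par G idx pos arcs s n') : n = n' := by
  obtain ⟨ℓ, m, h1, h2, rfl⟩ := h
  obtain ⟨ℓ', m', h1', h2', rfl⟩ := h'
  have hk : ∀ v, ∃ k : ℤ, ℓ' v = ℓ v + k * (2 * Real.pi * Complex.I) := fun v =>
    Complex.exp_eq_exp_iff_exists_int.1 ((h1' v).trans (h1 v).symm)
  choose k hk using hk
  rw [← sub_eq_zero, ← even_sum (G := G) hidx heven (fun v => (k v : ZMod 2)),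
    ← Finset.sum_sub_distrib]
  refine Finset.sum_congr rfl fun u _ => ?_
  rw [← Finset.sum_sub_distrib]
  refine Finset.sum_congr rfl fun v _ => ?_
  split_ifs with h
  · have e := (h2 u v h.1 h.2).unique (h2' u v h.1 h.2)
    rw [hk u, hk v] at e
    have e2 : (m u v : ℂ) = ((m' u v + k v - k u : ℤ) : ℂ) := by
      apply mul_right_cancel₀ two_pi_I_ne
      push_cast
      linear_combination e
    have e3 : m u v = m' u v + k v - k u := by exact_mod_cast e2
    rw [e3]
    push_cast
    ring
  · simp

theorem Par.exists (h0 : ∀ u v h, arcs u v h 0 = pos u) (h1 : ∀ u v h, arcs u v h 1 = pos v)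
    (hc : ∀ u v h, Continuous fun t => s (arcs u v h t))
    (hs : ∀ u v h t, s (arcs u v h t) ≠ 0) (hs' : ∀ v, s (pos v) ≠ 0) :
    ∃ n, Par G idx pos arcs s n := by
  classical
  have hm : ∀ u v, ∃ m : ℤ, ∀ h : G.Adj u v, IsVar (fun t => s (arcs u v h t))
      (Complex.log (s (pos v)) - Complex.log (s (pos u)) + m * (2 * Real.pi * Complex.I)) := by
    intro u v
    by_cases h : G.Adj u v
    · obtain ⟨L, hL, hL'⟩ := exists_log_I _ (hc u v h) (hs u v h)
      obtain ⟨a, ha⟩ := Complex.exp_eq_exp_iff_exists_int.1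
        (show Complex.exp (L 0) = Complex.exp (Complex.log (s (pos u))) by
          rw [hL', h0, Complex.exp_log (hs' u)])
      obtain ⟨b, hb⟩ := Complex.exp_eq_exp_iff_exists_int.1
        (show Complex.exp (L 1) = Complex.exp (Complex.log (s (pos v))) by
          rw [hL', h1, Complex.exp_log (hs' v)])
      refine ⟨b - a, fun _ => ⟨L, hL, hL', ?_⟩⟩
      rw [ha, hb]
      push_cast
      ring
    · exact ⟨0, fun h' => absurd h' h⟩
  choose m hm using hm
  exact ⟨_, fun v => Complex.log (s (pos v)), m, fun v => Complex.exp_log (hs' v),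
    fun u v h _ => hm u v h, rfl⟩

theorem Par.of_log {K : Set ℂ} (hs : LogOn K s) (h0 : ∀ u v h, arcs u v h 0 = pos u)
    (h1 : ∀ u v h, arcs u v h 1 = pos v) (hc : ∀ u v h, Continuous (arcs u v h))
    (hK : ∀ u v h t, arcs u v h t ∈ K) (hK' : ∀ v, pos v ∈ K) : Par G idx pos arcs s 0 := by
  obtain ⟨L, hL, hL'⟩ := hs
  refine ⟨fun v => L (pos v), fun _ _ => 0, fun v => hL' _ (hK' v), fun u v h _ =>
    ⟨fun t => L (arcs u v h t), hL.comp_continuous (hc u v h) (hK u v h),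
      fun t => hL' _ (hK u v h t), ?_⟩, by simp⟩
  simp [h0, h1]

theorem logOn_near (K : Set ℂ) (p q : ℂ) (h : ∀ z ∈ K, ‖p - q‖ < ‖z - q‖) :
    LogOn K (fun z => (z - p) / (z - q)) := by
  have hz : ∀ z ∈ K, z - q ≠ 0 := fun z hz => norm_pos_iff.1 ((norm_nonneg _).trans_lt (h z hz))
  apply LogOn.of_slit
  · exact ContinuousOn.div (by fun_prop) (by fun_prop) hz
  · intro z hzK
    have e : (z - p) / (z - q) = 1 + (q - p) / (z - q) := by
      have := hz z hzK
      field_simp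
      ring
    rw [e]
    apply Complex.mem_slitPlane_of_norm_lt_one
    rw [norm_div, div_lt_one (norm_pos_iff.2 (hz z hzK)), norm_sub_rev]
    exact h z hzK

theorem logOn_far (K : Set ℂ) (p : ℂ) (h : ∀ z ∈ K, ‖z‖ < ‖p‖) (hp : p ≠ 0) :
    LogOn K (fun z => z - p) := by
  have h1 : LogOn K (fun z => 1 + (- z / p)) := by
    apply LogOn.of_slit (by fun_prop)
    intro z hz
    apply Complex.mem_slitPlane_of_norm_lt_one
    rw [norm_div, div_lt_one (norm_pos_iff.2 hp), norm_neg]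
    exact h z hz
  refine (h1.mul (LogOn.const (neg_ne_zero.2 hp))).congr ?_
  intro z hz
  field_simp
  ring

theorem continuousOn_range_of_inj (e : unitInterval → ℂ) (he : Continuous e)
    (hi : Function.Injective e) (f : ℂ → ℂ) (hf : Continuous fun t => f (e t)) :
    ContinuousOn f (Set.range e) := by
  have hE : Topology.IsEmbedding e := (he.isClosedEmbedding hi).isEmbedding
  rw [continuousOn_iff_continuous_domRestrict]
  have : (Set.range e).domRestrict f = (fun t => f (e t)) ∘ hE.toHomeomorph.symm := by
    funext x
    have h := hE.toHomeomorph.apply_symm_apply x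
    have h2 : e (hE.toHomeomorph.symm x) = x := congrArg Subtype.val h
    simp only [Set.domRestrict_apply, Function.comp]
    rw [h2]
  rw [this]
  exact hf.comp hE.toHomeomorph.symm.continuous

theorem exists_sqrt (hidx : Function.Injective idx) (heven : ∀ v : V, Even (G.degree v))
    (h0 : ∀ u v h, arcs u v h 0 = pos u) (h1 : ∀ u v h, arcs u v h 1 = pos v)
    (hc : ∀ u v h, Continuous (arcs u v h)) (u0 v0 : V) (hadj : G.Adj u0 v0)
    (hlt : idx u0 < idx v0) (hinj : Function.Injective (arcs u0 v0 hadj)) (K1 : Set ℂ)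
    (hK1 : IsClosed K1) (hpos : ∀ v, pos v ∈ K1)
    (harc : ∀ u v h t, idx u < idx v → (u, v) ≠ (u0, v0) → arcs u v h t ∈ K1)
    (hend : ∀ t, arcs u0 v0 hadj t ∈ K1 → t = 0 ∨ t = 1) (p q : ℂ)
    (hp : p ∉ K1 ∪ Set.range (arcs u0 v0 hadj)) (hq : q ∉ K1 ∪ Set.range (arcs u0 v0 hadj))
    (hlog : LogOn K1 (fun z => (z - p) / (z - q))) (n : ZMod 2)
    (hpn : Par G idx pos arcs (fun z => z - p) n) (hqn : Par G idx pos arcs (fun z => z - q) n) :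
    ∃ s : ℂ → ℂ, ContinuousOn s (K1 ∪ Set.range (arcs u0 v0 hadj)) ∧
      ∀ z ∈ K1 ∪ Set.range (arcs u0 v0 hadj), s z ^ 2 * (z - q) = z - p := by
  classical
  set e := arcs u0 v0 hadj with he
  have hzp : ∀ z ∈ K1 ∪ Set.range e, z - p ≠ 0 := fun z hz h => hp (sub_eq_zero.1 h ▸ hz)
  have hzq : ∀ z ∈ K1 ∪ Set.range e, z - q ≠ 0 := fun z hz h => hq (sub_eq_zero.1 h ▸ hz)
  obtain ⟨L1, hL1, hL1'⟩ := hlog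
  have hec : Continuous e := hc u0 v0 hadj
  obtain ⟨M, hM, hM'⟩ := exists_log_I (fun t => (e t - p) / (e t - q))
    (Continuous.div (by fun_prop) (by fun_prop) (fun t => hzq _ (Or.inr ⟨t, rfl⟩)))
    (fun t => div_ne_zero (hzp _ (Or.inr ⟨t, rfl⟩)) (hzq _ (Or.inr ⟨t, rfl⟩)))
  obtain ⟨a, ha⟩ := Complex.exp_eq_exp_iff_exists_int.1
    (show Complex.exp (M 0) = Complex.exp (L1 (pos u0)) by
      rw [hM', hL1' _ (hpos u0), he, h0])
  obtain ⟨b, hb⟩ := Complex.exp_eq_exp_iff_exists_int.1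
    (show Complex.exp (M 1) = Complex.exp (L1 (pos v0)) by
      rw [hM', hL1' _ (hpos v0), he, h1])
  have hpar : Par G idx pos arcs (fun z => (z - p) / (z - q)) ((b - a : ℤ) : ZMod 2) := by
    refine ⟨fun v => L1 (pos v), fun u v => if (u, v) = (u0, v0) then b - a else 0,
      fun v => hL1' _ (hpos v), ?_, ?_⟩
    · intro u v h huv
      by_cases hc' : (u, v) = (u0, v0)
      · obtain ⟨rfl, rfl⟩ := Prod.mk.inj hc'
        refine ⟨M, hM, hM', ?_⟩
        beta_reduce
        rw [if_pos rfl, ha, hb]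
        push_cast
        ring
      · refine ⟨fun t => L1 (arcs u v h t),
          hL1.comp_continuous (hc u v h) (fun t => harc u v h t huv hc'),
          fun t => hL1' _ (harc u v h t huv hc'), ?_⟩
        beta_reduce
        rw [if_neg hc', h0, h1]
        simp
    · rw [Finset.sum_eq_single u0, Finset.sum_eq_single v0]
      · simp [hadj, hlt]
      · intro v _ hv
        simp [hv]
      · simp
      · intro u _ hu
        apply Finset.sum_eq_zero
        intro v _
        simp [hu]
      · simp
  have hin : ∀ u v h t, idx u < idx v → arcs u v h t ∈ K1 ∪ Set.range e := by
    intro u v h t huv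
    by_cases hc' : (u, v) = (u0, v0)
    · obtain ⟨rfl, rfl⟩ := Prod.mk.inj hc'
      exact Or.inr ⟨t, rfl⟩
    · exact Or.inl (harc u v h t huv hc')
  have hpar2 : Par G idx pos arcs (fun z => z - p) (((b - a : ℤ) : ZMod 2) + n) := by
    refine (hpar.mul hqn).congr ?_ ?_
    · intro v
      exact div_mul_cancel₀ _ (hzq _ (Or.inl (hpos v)))
    · intro u v h t huv
      exact div_mul_cancel₀ _ (hzq _ (hin u v h t huv))
  have hz : ((b - a : ℤ) : ZMod 2) = 0 := by
    have := hpar2.unique hidx heven hpn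
    simpa using this
  rw [ZMod.intCast_zmod_eq_zero_iff_dvd] at hz
  obtain ⟨j, hj⟩ := hz
  have hj' : (b : ℂ) - a = 2 * j := by exact_mod_cast congrArg (Int.cast : ℤ → ℂ) hj
  set s : ℂ → ℂ := fun z => if z ∈ K1 then Complex.exp (L1 z / 2) else
    Complex.exp ((M (Function.invFun e z) - a * (2 * Real.pi * Complex.I)) / 2) with hs
  have hse : ∀ t, s (e t) = Complex.exp ((M t - a * (2 * Real.pi * Complex.I)) / 2) := by
    intro t
    simp only [hs]
    split_ifs with h
    · rcases hend t h with rfl | rfl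
      · rw [he, h0, ha]
        congr 1
        ring
      · rw [he, h1, hb]
        have : (L1 (pos v0) + b * (2 * Real.pi * Complex.I) - a * (2 * Real.pi * Complex.I)) / 2
            = L1 (pos v0) / 2 + j * (2 * Real.pi * Complex.I) := by
          linear_combination (Real.pi * Complex.I) * hj'
        rw [this, Complex.exp_add, Complex.exp_int_mul_two_pi_mul_I, mul_one]
    · rw [Function.leftInverse_invFun hinj t]
  refine ⟨s, ?_, ?_⟩
  · apply ContinuousOn.union_of_isClosed _ _ hK1 (isCompact_range hec).isClosed
    · have : ContinuousOn (fun z => Complex.exp (L1 z / 2)) K1 := by fun_prop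
      refine this.congr ?_
      intro z hz
      simp only [hs]
      rw [if_pos hz]
    · apply continuousOn_range_of_inj e hec hinj
      simp only [hse]
      fun_prop
  · have hsq : ∀ w : ℂ, Complex.exp (w / 2) ^ 2 = Complex.exp w := by
      intro w
      rw [← Complex.exp_nat_mul]
      congr 1
      push_cast
      ring
    rintro z (hz | ⟨t, rfl⟩)
    · have : s z = Complex.exp (L1 z / 2) := by
        simp only [hs]
        rw [if_pos hz]
      rw [this, hsq, hL1' z hz]
      exact div_mul_cancel₀ _ (hzq _ (Or.inl hz))
    · rw [hse, hsq, Complex.exp_sub, Complex.exp_int_mul_two_pi_mul_I, hM', div_one]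
      exact div_mul_cancel₀ _ (hzq _ (Or.inr ⟨t, rfl⟩))

end
theorem exists_chart (x0 : Sph) : ∃ (φ : Sph → ℂ) (ψ : ℂ → Sph), ContinuousOn φ {x0}ᶜ ∧
    Continuous ψ ∧ (∀ z, φ (ψ z) = z) ∧ (∀ z, ψ z ≠ x0) ∧ ∀ x, x ≠ x0 → ψ (φ x) = x := by
  have : Fact (Module.finrank ℝ (EuclideanSpace ℝ (Fin 3)) = 2 + 1) := ⟨by simp⟩
  set S := stereographic' 2 x0
  have hsrc : S.source = {x0}ᶜ := stereographic'_source x0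
  have htgt : S.target = Set.univ := stereographic'_target x0
  set E := Complex.orthonormalBasisOneI.repr
  refine ⟨fun x => E.symm (S x), fun z => S.symm (E z), ?_, ?_, ?_, ?_, ?_⟩
  · rw [← hsrc]
    exact E.symm.continuous.comp_continuousOn S.continuousOn
  · have h := S.continuousOn_symm
    rw [htgt, continuousOn_univ] at h
    exact h.comp E.continuous
  · intro z
    simp only
    rw [S.right_inv (by rw [htgt]; trivial), E.symm_apply_apply]
  · intro z
    have := S.map_target (x := E z) (by rw [htgt]; trivial)
    rw [hsrc] at this
    exact this
  · intro x hx
    simp only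
    rw [E.apply_symm_apply, S.left_inv (by rw [hsrc]; exact hx)]

theorem exists_ball_disjoint (K : Set ℂ) (hK : IsClosed K) (p : ℂ) (hp : p ∉ K) :
    ∃ r > 0, ∀ z ∈ K, r ≤ ‖z - p‖ := by
  obtain ⟨r, hr, h⟩ := Metric.isOpen_iff.1 hK.isOpen_compl p hp
  refine ⟨r, hr, fun z hz => ?_⟩
  by_contra hlt
  push Not at hlt
  exact h (by rwa [Metric.mem_ball, dist_eq_norm]) hz

namespace SphereEmbedding
variable {V : Type*} [Fintype V] {G : SimpleGraph V} (F : SphereEmbedding G)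

theorem isCompact_image : IsCompact F.image := by
  have : Finite {p : V × V // G.Adj p.1 p.2} := inferInstance
  refine (Set.finite_range F.pos).isCompact.union (isCompact_iUnion fun p => ?_)
  exact isCompact_range (F.arc p.2).continuous

theorem pos_mem (v : V) : F.pos v ∈ F.image := Or.inl ⟨v, rfl⟩

theorem arc_mem (u v : V) (h : G.Adj u v) (t : unitInterval) : F.arc h t ∈ F.image :=
  Or.inr (Set.mem_iUnion.2 ⟨⟨(u, v), h⟩, t, rfl⟩)

theorem arc_end (u v : V) (h : G.Adj u v) (t : unitInterval)
    (ht : F.arc h t ∈ ({F.pos u, F.pos v} : Set Sph)) : t = 0 ∨ t = 1 := by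
  rcases ht with ht | ht
  · left
    apply F.arc_inj h
    rw [ht, Path.source]
  · right
    apply F.arc_inj h
    rw [Set.mem_singleton_iff.1 ht, Path.target]

theorem range_symm (u v : V) (h : G.Adj u v) :
    Set.range (F.arc h.symm) = Set.range (F.arc h) := by
  rw [F.arc_symm, Path.symm_range]

theorem openArc_symm (u v : V) (h : G.Adj u v) : F.openArc h.symm = F.openArc h := by
  unfold openArc
  rw [range_symm, Set.pair_comm]

/-- The part of the graph away from the edge `uv`. -/
def rest (u v : V) : Set Sph :=
  Set.range F.pos ∪ ⋃ p : {p : {p : V × V // G.Adj p.1 p.2} // s(p.1.1, p.1.2) ≠ s(u, v)},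
    Set.range (F.arc p.1.2)

theorem isCompact_rest (u v : V) : IsCompact (F.rest u v) := by
  refine (Set.finite_range F.pos).isCompact.union (isCompact_iUnion fun p => ?_)
  exact isCompact_range (F.arc p.1.2).continuous

theorem rest_union (u v : V) (h : G.Adj u v) :
    F.rest u v ∪ Set.range (F.arc h) = F.image := by
  apply Set.Subset.antisymm
  · rintro x ((hx | hx) | ⟨t, rfl⟩)
    · exact Or.inl hx
    · obtain ⟨p, t, rfl⟩ := Set.mem_iUnion.1 hx
      exact F.arc_mem _ _ p.1.2 t
    · exact F.arc_mem _ _ h t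
  · rintro x (hx | hx)
    · exact Or.inl (Or.inl hx)
    · obtain ⟨⟨⟨a, b⟩, p⟩, hx⟩ := Set.mem_iUnion.1 hx
      by_cases hs : s(a, b) = s(u, v)
      · right
        rcases Sym2.eq_iff.1 hs with ⟨rfl, rfl⟩ | ⟨rfl, rfl⟩
        · exact hx
        · rw [← F.range_symm]
          exact hx
      · exact Or.inl (Or.inr (Set.mem_iUnion.2 ⟨⟨⟨(a, b), p⟩, hs⟩, hx⟩))

theorem rest_end (u v : V) (h : G.Adj u v) (t : unitInterval) (ht : F.arc h t ∈ F.rest u v) :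
    t = 0 ∨ t = 1 := by
  apply F.arc_end u v h
  rcases ht with ⟨w, hw⟩ | ht
  · rcases F.arc_avoid h w ⟨t, hw.symm⟩ with rfl | rfl
    · exact Or.inl hw.symm
    · exact Or.inr hw.symm
  · obtain ⟨p, hp⟩ := Set.mem_iUnion.1 ht
    exact (F.arc_disj h p.1.2 p.2.symm ⟨⟨t, rfl⟩, hp⟩).1

/-- Parity of a function along the image of the graph in the plane. -/
abbrev parity [DecidableRel G.Adj] (idx : V → ℕ) (φ : Sph → ℂ) (s : ℂ → ℂ) (n : ZMod 2) : Prop :=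
  Par G idx (fun v => φ (F.pos v)) (fun _ _ h t => φ (F.arc h t)) s n

theorem arc_cont (x0 : Sph) (hx0 : x0 ∉ F.image) (φ : Sph → ℂ) (hφ : ContinuousOn φ {x0}ᶜ)
    (u v : V) (h : G.Adj u v) : Continuous fun t => φ (F.arc h t) :=
  hφ.comp_continuous (F.arc h).continuous fun t ht => hx0 (ht ▸ F.arc_mem u v h t)

theorem exists_colour [DecidableRel G.Adj] (idx : V → ℕ) (hidx : Function.Injective idx)
    (heven : ∀ v : V, Even (G.degree v)) (x0 : Sph) (hx0 : x0 ∉ F.image) (φ : Sph → ℂ)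
    (ψ : ℂ → Sph) (hφ : ContinuousOn φ {x0}ᶜ) (hψ : Continuous ψ)
    (hψ0 : ∀ z, ψ z ≠ x0) (hψφ : ∀ x, x ≠ x0 → ψ (φ x) = x) :
    ∃ c : Sph → ZMod 2, ContinuousOn c F.imageᶜ ∧
      ∀ x, x ∉ F.image → x ≠ x0 → F.parity idx φ (fun z => z - φ x) (c x) := by
  classical
  have hne : ∀ y ∈ F.image, y ≠ x0 := fun y hy h => hx0 (h ▸ hy)
  have hφinj : ∀ x y, x ≠ x0 → y ≠ x0 → φ x = φ y → x = y := by
    intro x y hx hy h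
    rw [← hψφ x hx, ← hψφ y hy, h]
  have hcont := F.arc_cont x0 hx0 φ hφ
  set K := φ '' F.image with hK
  have hKc : IsCompact K := F.isCompact_image.image_of_continuousOn (hφ.mono hne)
  have hKn : ∀ x, x ∉ F.image → x ≠ x0 → φ x ∉ K := by
    rintro x hx hxx ⟨y, hy, h⟩
    exact hx (hφinj y x (hne y hy) hxx h ▸ hy)
  have hKpos : ∀ v, φ (F.pos v) ∈ K := fun v => ⟨_, F.pos_mem v, rfl⟩
  have hKarc : ∀ u v (h : G.Adj u v) t, φ (F.arc h t) ∈ K :=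
    fun u v h t => ⟨_, F.arc_mem u v h t, rfl⟩
  have hex : ∀ x, ∃ n, (x = x0 → n = 0) ∧
      (x ∉ F.image → x ≠ x0 → F.parity idx φ (fun z => z - φ x) n) := by
    intro x
    by_cases hx : x ∉ F.image ∧ x ≠ x0
    · obtain ⟨n, hn⟩ := Par.exists (G := G) (idx := idx) (pos := fun v => φ (F.pos v))
        (arcs := fun _ _ h t => φ (F.arc h t)) (s := fun z => z - φ x)
        (fun u v h => by simp) (fun u v h => by simp)
        (fun u v h => (hcont u v h).sub continuous_const)
        (fun u v h t e => hKn x hx.1 hx.2 (sub_eq_zero.1 e ▸ hKarc u v h t))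
        (fun v e => hKn x hx.1 hx.2 (sub_eq_zero.1 e ▸ hKpos v))
      exact ⟨n, fun e => absurd e hx.2, fun _ _ => hn⟩
    · exact ⟨0, fun _ => rfl, fun h1 h2 => absurd ⟨h1, h2⟩ hx⟩
  choose c hc0 hc using hex
  have hlogpar : ∀ s, LogOn K s → F.parity idx φ s 0 := fun s hs =>
    Par.of_log hs (fun u v h => by simp) (fun u v h => by simp) hcont hKarc hKpos
  refine ⟨c, ?_, hc⟩
  intro x hx
  suffices h : ∀ᶠ y in nhds x, y ∉ F.image → c y = c x by
    have h2 : ∀ᶠ y in nhdsWithin x F.imageᶜ, c y = c x := by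
      filter_upwards [mem_nhdsWithin_of_mem_nhds h, self_mem_nhdsWithin] with y hy hy2
      exact hy hy2
    exact tendsto_const_nhds.congr' (h2.mono fun y hy => hy.symm)
  by_cases hxx : x = x0
  · subst hxx
    obtain ⟨R0, hR0⟩ := hKc.isBounded.subset_closedBall 0
    have hopen : IsOpen (ψ '' Metric.closedBall 0 |R0|)ᶜ :=
      ((isCompact_closedBall (0 : ℂ) |R0|).image hψ).isClosed.isOpen_compl
    have hmem : x ∈ (ψ '' Metric.closedBall 0 |R0|)ᶜ := by
      rintro ⟨z, -, hz⟩
      exact hψ0 z hz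
    filter_upwards [hopen.mem_nhds hmem] with y hy hyi
    by_cases hyx : y = x
    · rw [hyx]
    · have hlt : |R0| < ‖φ y‖ := by
        by_contra hle
        push Not at hle
        exact hy ⟨φ y, mem_closedBall_zero_iff.2 hle, hψφ y hyx⟩
      have hfar : LogOn K (fun z => z - φ y) := by
        apply logOn_far
        · intro z hz
          have := mem_closedBall_zero_iff.1 (hR0 hz)
          exact (this.trans (le_abs_self R0)).trans_lt hlt
        · exact norm_pos_iff.1 ((abs_nonneg R0).trans_lt hlt)
      rw [hc0 x rfl]
      exact (hc y hyi hyx).unique hidx heven (hlogpar _ hfar)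
  · obtain ⟨r, hr, hrK⟩ := exists_ball_disjoint K hKc.isClosed (φ x) (hKn x hx hxx)
    have hca : ContinuousAt φ x := hφ.continuousAt (isOpen_compl_singleton.mem_nhds hxx)
    filter_upwards [hca.eventually (Metric.ball_mem_nhds (φ x) hr),
      isOpen_compl_singleton.mem_nhds hxx] with y hy hyx hyi
    rw [dist_eq_norm] at hy
    have hlog := logOn_near K (φ y) (φ x) (fun z hz => hy.trans_le (hrK z hz))
    have hzx : ∀ z ∈ K, z - φ x ≠ 0 := fun z hz e => hKn x hx hxx (sub_eq_zero.1 e ▸ hz)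
    have h1 : F.parity idx φ (fun z => z - φ y) (0 + c x) :=
      ((hlogpar _ hlog).mul (hc x hx hxx)).congr
        (fun v => div_mul_cancel₀ _ (hzx _ (hKpos v)))
        (fun u v h t _ => div_mul_cancel₀ _ (hzx _ (hKarc u v h t)))
    rw [zero_add] at h1
    exact (hc y hyi hyx).unique hidx heven h1

theorem adj_colour [DecidableRel G.Adj] (idx : V → ℕ) (hidx : Function.Injective idx)
    (heven : ∀ v : V, Even (G.degree v)) (x0 : Sph) (hx0 : x0 ∉ F.image) (φ : Sph → ℂ)
    (ψ : ℂ → Sph) (hφ : ContinuousOn φ {x0}ᶜ) (hψ : Continuous ψ) (hφψ : ∀ z, φ (ψ z) = z)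
    (hψ0 : ∀ z, ψ z ≠ x0) (hψφ : ∀ x, x ≠ x0 → ψ (φ x) = x) (c : Sph → ZMod 2)
    (hc : ∀ x, x ∉ F.image → x ≠ x0 → F.parity idx φ (fun z => z - φ x) (c x))
    (a b : Sph) (hab : connectedComponentIn F.imageᶜ a ≠ connectedComponentIn F.imageᶜ b)
    (ha0 : x0 ∉ connectedComponentIn F.imageᶜ a) (u v : V) (h : G.Adj u v) (huv : idx u < idx v)
    (ha : F.openArc h ⊆ closure (connectedComponentIn F.imageᶜ a))
    (hb : F.openArc h ⊆ closure (connectedComponentIn F.imageᶜ b)) :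
    ∃ p ∈ connectedComponentIn F.imageᶜ a, ∃ q ∈ connectedComponentIn F.imageᶜ b, c p ≠ c q := by
  classical
  have hne : ∀ y ∈ F.image, y ≠ x0 := fun y hy h => hx0 (h ▸ hy)
  have hφinj : ∀ x y, x ≠ x0 → y ≠ x0 → φ x = φ y → x = y := by
    intro x y hx hy h
    rw [← hψφ x hx, ← hψφ y hy, h]
  have hcont := F.arc_cont x0 hx0 φ hφ
  have hKn : ∀ x, x ∉ F.image → x ≠ x0 → φ x ∉ φ '' F.image := by
    rintro x hx hxx ⟨y, hy, h⟩
    exact hx (hφinj y x (hne y hy) hxx h ▸ hy)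
  have hsub : F.rest u v ⊆ F.image := by
    rw [← F.rest_union u v h]
    exact Set.subset_union_left
  set K1 := φ '' F.rest u v with hK1
  have hK1c : IsCompact K1 :=
    (F.isCompact_rest u v).image_of_continuousOn (hφ.mono fun y hy => hne y (hsub hy))
  have hKeq : K1 ∪ Set.range (fun t => φ (F.arc h t)) = φ '' F.image := by
    rw [← F.rest_union u v h, Set.image_union, ← Set.range_comp]
    rfl
  have hKc : IsCompact (φ '' F.image) :=
    F.isCompact_image.image_of_continuousOn (hφ.mono hne)
  have hend : ∀ t, φ (F.arc h t) ∈ K1 → t = 0 ∨ t = 1 := by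
    rintro t ⟨y, hy, hyt⟩
    have := hφinj y _ (hne y (hsub hy)) (hne _ (F.arc_mem u v h t)) hyt
    exact F.rest_end u v h t (this ▸ hy)
  obtain ⟨t0, ht0, ht1⟩ : ∃ t : unitInterval, t ≠ 0 ∧ t ≠ 1 := by
    refine ⟨⟨1 / 2, by norm_num, by norm_num⟩, ?_, ?_⟩ <;>
    · intro e
      have := congrArg Subtype.val e
      norm_num at this
  have hm : F.arc h t0 ∈ F.openArc h :=
    ⟨⟨t0, rfl⟩, fun e => (F.arc_end u v h t0 e).elim ht0 ht1⟩
  have hmK : φ (F.arc h t0) ∉ K1 := fun e => (hend t0 e).elim ht0 ht1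
  obtain ⟨r, hr, hrK⟩ := exists_ball_disjoint K1 hK1c.isClosed _ hmK
  have hm0 := hne _ (F.arc_mem u v h t0)
  have hU : φ ⁻¹' Metric.ball (φ (F.arc h t0)) (r / 4) ∩ {x0}ᶜ ∈ nhds (F.arc h t0) :=
    Filter.inter_mem ((hφ.continuousAt (isOpen_compl_singleton.mem_nhds hm0)).eventually
      (Metric.ball_mem_nhds _ (by positivity))) (isOpen_compl_singleton.mem_nhds hm0)
  obtain ⟨p, ⟨hpm, hp0⟩, hpa⟩ := mem_closure_iff_nhds.1 (ha hm) _ hU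
  obtain ⟨q, ⟨hqm, hq0⟩, hqb⟩ := mem_closure_iff_nhds.1 (hb hm) _ hU
  refine ⟨p, hpa, q, hqb, fun hpq => ?_⟩
  have hpi : p ∉ F.image := connectedComponentIn_subset _ _ hpa
  have hqi : q ∉ F.image := connectedComponentIn_subset _ _ hqb
  have hpm' : ‖φ p - φ (F.arc h t0)‖ < r / 4 := by
    rw [← dist_eq_norm]; exact hpm
  have hqm' : ‖φ q - φ (F.arc h t0)‖ < r / 4 := by
    rw [← dist_eq_norm]; exact hqm
  have hlog : LogOn K1 (fun z => (z - φ p) / (z - φ q)) := by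
    apply logOn_near
    intro z hz
    have h1 := hrK z hz
    have h2 := norm_sub_le (φ p - φ (F.arc h t0)) (φ q - φ (F.arc h t0))
    have h3 := norm_add_le (z - φ q) (φ q - φ (F.arc h t0))
    rw [sub_sub_sub_cancel_right] at h2
    rw [sub_add_sub_cancel] at h3
    linarith
  obtain ⟨s, hs, hs2⟩ := exists_sqrt (G := G) (idx := idx) (pos := fun v => φ (F.pos v))
    (arcs := fun _ _ h t => φ (F.arc h t)) hidx heven
    (fun u v h => by simp) (fun u v h => by simp) hcont u v h huv
    (fun t t' e => F.arc_inj h (hφinj _ _ (hne _ (F.arc_mem u v h t))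
      (hne _ (F.arc_mem u v h t')) e))
    K1 hK1c.isClosed (fun w => ⟨_, Or.inl ⟨w, rfl⟩, rfl⟩)
    (by
      intro u' v' h' t hlt hne'
      refine ⟨F.arc h' t, Or.inr (Set.mem_iUnion.2 ⟨⟨⟨(u', v'), h'⟩, ?_⟩, t, rfl⟩), rfl⟩
      intro e
      rcases Sym2.eq_iff.1 e with ⟨e1, e2⟩ | ⟨e1, e2⟩
      · exact hne' (Prod.ext e1 e2)
      · have e1' : u' = v := e1
        have e2' : v' = u := e2
        rw [e1', e2'] at hlt
        exact absurd hlt huv.not_gt)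
    hend (φ p) (φ q) (by rw [hKeq]; exact hKn p hpi hp0) (by rw [hKeq]; exact hKn q hqi hq0)
    hlog (c q) (hpq ▸ hc p hpi hp0) (hc q hqi hq0)
  rw [hKeq] at hs hs2
  have hpa' := connectedComponentIn_eq hpa
  have hqb' := connectedComponentIn_eq hqb
  set D := connectedComponentIn (φ '' F.image)ᶜ (φ p) with hD
  have hDS : ∀ z ∈ D, ψ z ∈ connectedComponentIn F.imageᶜ a := by
    have h1 : ψ '' D ⊆ connectedComponentIn F.imageᶜ p := by
      apply IsPreconnected.subset_connectedComponentIn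
      · exact isPreconnected_connectedComponentIn.image _ hψ.continuousOn
      · exact ⟨φ p, mem_connectedComponentIn (hKn p hpi hp0), hψφ p hp0⟩
      · rintro _ ⟨z, hz, rfl⟩ hzi
        exact connectedComponentIn_subset _ _ hz ⟨ψ z, hzi, hφψ z⟩
    intro z hz
    rw [hpa']
    exact h1 ⟨z, hz, rfl⟩
  have : LocallyConnectedSpace Sph := by
    have : Fact (Module.finrank ℝ (EuclideanSpace ℝ (Fin 3)) = 2 + 1) := ⟨by simp⟩
    exact ChartedSpace.locallyConnectedSpace (EuclideanSpace ℝ (Fin 2)) Sph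
  set N := connectedComponentIn F.imageᶜ x0 with hN
  have hNo : IsOpen N := F.isCompact_image.isClosed.isOpen_compl.connectedComponentIn
  have hNx : x0 ∈ N := mem_connectedComponentIn hx0
  have hbd : Bornology.IsBounded D := by
    have h1 : IsCompact (φ '' Nᶜ) :=
      hNo.isClosed_compl.isCompact.image_of_continuousOn
        (hφ.mono fun y hy e => hy ((Set.mem_singleton_iff.1 e) ▸ hNx))
    refine h1.isBounded.subset ?_
    intro z hz
    refine ⟨ψ z, fun hzN => ha0 ?_, hφψ z⟩
    rw [connectedComponentIn_eq (hDS z hz), ← connectedComponentIn_eq hzN]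
    exact hNx
  refine plane_key _ hKc (φ p) (φ q) (hKn p hpi hp0) (hKn q hqi hq0) hbd ?_ s hs hs2
  intro hqD
  have h1 := hDS _ hqD
  rw [hψφ q hq0] at h1
  exact hab ((connectedComponentIn_eq h1).trans hqb'.symm)

end SphereEmbedding

/-- Let `𝔓 = (P, A)` be a polyhedral graph (connected simple graph embedded in the
sphere, every vertex of degree at least 2) in which every point has even valency.
Then the faces admit a proper 2-colouring: there is `c : Faces → Fin 2` such that
no two adjacent faces receive the same colour. -/
theorem stmt12 {V : Type*} [Fintype V] (G : SimpleGraph V) [DecidableRel G.Adj]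
    (hconn : G.Connected) (hmin : ∀ v : V, 2 ≤ G.degree v)
    (F : SphereEmbedding G)
    (heven : ∀ v : V, Even (G.degree v)) :
    ∃ c : F.Faces → Fin 2, ∀ S T : F.Faces,
      S.1 ≠ T.1 → F.FaceAdj S.1 T.1 → c S ≠ c T := by
  classical
  by_cases hx : ∃ x0, x0 ∉ F.image
  swap
  · exact ⟨fun _ => 0, fun S => by
      obtain ⟨x, hx', -⟩ := S.2
      exact absurd ⟨x, hx'⟩ hx⟩
  obtain ⟨x0, hx0⟩ := hx
  obtain ⟨φ, ψ, hφ, hψ, hφψ, hψ0, hψφ⟩ := exists_chart x0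
  set idx : V → ℕ := fun v => (Fintype.equivFin V v : ℕ) with hidxdef
  have hidx : Function.Injective idx := fun a b hab =>
    (Fintype.equivFin V).injective (Fin.ext hab)
  obtain ⟨c, hcc, hc⟩ := F.exists_colour idx hidx heven x0 hx0 φ ψ hφ hψ hψ0 hψφ
  have hconst : ∀ a, ∀ p ∈ connectedComponentIn F.imageᶜ a,
      ∀ q ∈ connectedComponentIn F.imageᶜ a, c p = c q := fun a p hp q hq =>
    isPreconnected_connectedComponentIn.constant
      (hcc.mono (connectedComponentIn_subset _ _)) hp hq
  have key : ∀ a b, a ∉ F.image → b ∉ F.image →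
      connectedComponentIn F.imageᶜ a ≠ connectedComponentIn F.imageᶜ b →
      F.FaceAdj (connectedComponentIn F.imageᶜ a) (connectedComponentIn F.imageᶜ b) →
      x0 ∉ connectedComponentIn F.imageᶜ a → c a ≠ c b := by
    rintro a b ha hb hab ⟨u, v, h, h1, h2⟩ ha0
    obtain ⟨p, hp, q, hq, hpq⟩ : ∃ p ∈ connectedComponentIn F.imageᶜ a,
        ∃ q ∈ connectedComponentIn F.imageᶜ b, c p ≠ c q := by
      rcases lt_or_gt_of_ne (fun e => h.ne (hidx e) : idx u ≠ idx v) with hlt | hlt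
      · exact F.adj_colour idx hidx heven x0 hx0 φ ψ hφ hψ hφψ hψ0 hψφ c hc a b hab ha0 u v h
          hlt h1 h2
      · exact F.adj_colour idx hidx heven x0 hx0 φ ψ hφ hψ hφψ hψ0 hψφ c hc a b hab ha0 v u
          h.symm hlt (by rwa [F.openArc_symm]) (by rwa [F.openArc_symm])
    rw [hconst a a (mem_connectedComponentIn ha) p hp,
      hconst b b (mem_connectedComponentIn hb) q hq]
    exact hpq
  have hrep : ∀ S : F.Faces, ∃ x : Sph, x ∉ F.image ∧ S.1 = connectedComponentIn F.imageᶜ x :=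
    fun S => S.2
  choose x hxi hxS using hrep
  refine ⟨fun S => (c (x S) : ZMod 2), fun S T hST hadj => ?_⟩
  rw [hxS S, hxS T] at hST hadj
  show c (x S) ≠ c (x T)
  by_cases hS : x0 ∈ connectedComponentIn F.imageᶜ (x S)
  · have hT : x0 ∉ connectedComponentIn F.imageᶜ (x T) := fun hT =>
      hST ((connectedComponentIn_eq hS).trans (connectedComponentIn_eq hT).symm)
    obtain ⟨u, v, h, h1, h2⟩ := hadj
    exact (key _ _ (hxi T) (hxi S) hST.symm ⟨u, v, h, h2, h1⟩ hT).symm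
  · exact key _ _ (hxi S) (hxi T) hST hadj hS
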